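/- There exist absolute constants C, C' such that the following holds. Let D = ×_{i=1}^n D_i and D̂ = ×_{i=1}^n D̂_i be product distributions with each D_i and D̂_i supported on [0,H]^m, and suppose the Prokhorov distance satisfies ‖D_i − D̂_i‖_P ≤ ε for every i. Then |OPT(D) − OPT(D̂)| ≤ C·(nκ + n√(mLHκ)), where κ = C'·(nmLHε + mL√(nHε)) and OPT denotes the optimal revenue over BIC and IR mechanisms. -/

import Mathlib

open MeasureTheory Set

namespace MultiItem

/-- Feasible deterministic allocations of `m` items to `n` bidders: each item goes to at
most one bidder. -/
def Alloc (n m : ℕ) : Type :=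
  {x : Fin n → Fin m → Bool // ∀ j : Fin m, (Finset.univ.filter fun i => x i j = true).card ≤ 1}

instance (n m : ℕ) : Fintype (Alloc n m) := by
  unfold Alloc; infer_instance

instance (n m : ℕ) : DecidableEq (Alloc n m) := by
  unfold Alloc; infer_instance

/-- The empty allocation: nobody gets anything. -/
def emptyAlloc (n m : ℕ) : Alloc n m :=
  ⟨fun _ _ => false, by intro j; simp⟩

/-- Measurable-space structure on `Option α`: a set is measurable iff its preimage under
`some` is measurable. -/
instance {α : Type*} [m₀ : MeasurableSpace α] : MeasurableSpace (Option α) :=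
  MeasurableSpace.map some m₀

/-- A (randomized) multi-item mechanism, represented by the distribution over allocations
and the expected payments induced on each bid profile; the bid `none` is the
non-participation symbol `⊥`, which results in the empty allocation and zero payments. -/
structure Mechanism (n m : ℕ) where
  allocProb : (Fin n → Option (Fin m → ℝ)) → Alloc n m → ℝ
  pay : (Fin n → Option (Fin m → ℝ)) → Fin n → ℝ
  allocProb_nonneg : ∀ b x, 0 ≤ allocProb b x
  allocProb_sum_one : ∀ b, ∑ x : Alloc n m, allocProb b x = 1
  optOut : ∀ b, (∃ i, b i = none) →
    (allocProb b = fun x => if x = emptyAlloc n m then 1 else 0) ∧ pay b = fun _ => 0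
  meas_allocProb : ∀ x, Measurable fun b => allocProb b x
  meas_pay : ∀ i, Measurable fun b => pay b i

variable {n m : ℕ}

/-- Expected utility of bidder `i` with type `t` under bid profile `b`, for the valuation
profile `v`. -/
def util (v : Fin n → (Fin m → ℝ) → Alloc n m → ℝ) (M : Mechanism n m)
    (i : Fin n) (t : Fin m → ℝ) (b : Fin n → Option (Fin m → ℝ)) : ℝ :=
  (∑ x : Alloc n m, M.allocProb b x * v i t x) - M.pay b i

/-- (Ex-post) individual rationality on type profiles from `[0,H]^m`. -/
def IsIR (H : ℝ) (v : Fin n → (Fin m → ℝ) → Alloc n m → ℝ) (M : Mechanism n m) : Prop :=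
  ∀ t : Fin n → Fin m → ℝ, (∀ i j, t i j ∈ Icc (0:ℝ) H) →
    ∀ i, 0 ≤ util v M i (t i) fun j => some (t j)

/-- Interim expected utility of bidder `i` with type `t` bidding `bid`, when all other
bidders bid their true types drawn from `D`. -/
noncomputable def interim (v : Fin n → (Fin m → ℝ) → Alloc n m → ℝ) (M : Mechanism n m)
    (D : Fin n → Measure (Fin m → ℝ)) (i : Fin n) (t : Fin m → ℝ)
    (bid : Option (Fin m → ℝ)) : ℝ :=
  ∫ b, util v M i t (fun j => if j = i then bid else some (b j)) ∂(Measure.pi D)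

/-- The (topological) support of a measure. -/
def msupport {α : Type*} [TopologicalSpace α] [MeasurableSpace α] (μ : Measure α) : Set α :=
  {x | ∀ U : Set α, IsOpen U → x ∈ U → 0 < μ U}

/-- `η`-Bayesian incentive compatibility w.r.t. the product of the `D i` (misreports range
over types in `[0,H]^m` and the non-participation bid `⊥`). -/
def IsBIC (η H : ℝ) (v : Fin n → (Fin m → ℝ) → Alloc n m → ℝ)
    (M : Mechanism n m) (D : Fin n → Measure (Fin m → ℝ)) : Prop :=
  ∀ i : Fin n, ∀ t ∈ msupport (D i), ∀ bid : Option (Fin m → ℝ),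
    (∀ s ∈ bid, ∀ j, s j ∈ Icc (0:ℝ) H) →
    interim v M D i t bid ≤ interim v M D i t (some t) + η

/-- Expected revenue under truthful bidding from `D`. -/
noncomputable def RevT (M : Mechanism n m) (D : Fin n → Measure (Fin m → ℝ)) : ℝ :=
  ∫ b, (∑ i, M.pay (fun j => some (b j)) i) ∂(Measure.pi D)

/-- Optimal revenue over `η`-BIC and IR mechanisms. -/
noncomputable def OPT (η H : ℝ) (v : Fin n → (Fin m → ℝ) → Alloc n m → ℝ)
    (D : Fin n → Measure (Fin m → ℝ)) : ℝ :=
  sSup {r | ∃ M : Mechanism n m, IsIR H v M ∧ IsBIC η H v M D ∧ r = RevT M D}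

/-- The distribution is supported on the box `[0,H]^m`. -/
def suppBox (H : ℝ) (μ : Measure (Fin m → ℝ)) : Prop :=
  μ {t | ∀ j, t j ∈ Icc (0:ℝ) H} = 1

/-- The total variation distance between `P` and `Q` is at most `ε`. -/
def TVLe {α : Type*} [MeasurableSpace α] (P Q : Measure α) (ε : ℝ) : Prop :=
  ∀ A : Set α, MeasurableSet A → |(P A).toReal - (Q A).toReal| ≤ ε

/-- The total variation distance between two measures. -/
noncomputable def tvDist {α : Type*} [MeasurableSpace α] (P Q : Measure α) : ℝ :=
  sSup {r | ∃ A : Set α, MeasurableSet A ∧ r = |(P A).toReal - (Q A).toReal|}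

/-- The Prokhorov distance (w.r.t. the `ℓ1` metric) between `P` and `Q` is at most `ε`. -/
def ProkhorovLe {k : ℕ} (P Q : Measure (Fin k → ℝ)) (ε : ℝ) : Prop :=
  ∀ ε' : ℝ, ε < ε' → ∀ A : Set (Fin k → ℝ), MeasurableSet A →
    P A ≤ Q {x | ∃ y ∈ A, (∑ j, |x j - y j|) < ε'} + ENNReal.ofReal ε' ∧
    Q A ≤ P {x | ∃ y ∈ A, (∑ j, |x j - y j|) < ε'} + ENNReal.ofReal ε'

/-- Round `x ≥ 0` down to the grid `{0} ∪ {ℓ + i·δ : i ∈ ℤ≥0}`. -/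
noncomputable def roundPt (ℓ δ x : ℝ) : ℝ :=
  if x < ℓ then 0 else ℓ + ⌊(x - ℓ) / δ⌋ * δ

/-- The pushforward `⌊F⌋_{ℓ,δ}` of a distribution under coordinatewise rounding. -/
noncomputable def roundMeasure {k : ℕ} (ℓ : Fin k → ℝ) (δ : ℝ)
    (F : Measure (Fin k → ℝ)) : Measure (Fin k → ℝ) :=
  F.map fun x j => roundPt (ℓ j) δ (x j)

end MultiItem

open MeasureTheory Set
namespace MultiItem

theorem prok_integral {k : ℕ} (P Q : Measure (Fin k → ℝ)) [IsProbabilityMeasure P]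
    [IsProbabilityMeasure Q] (ε ε' : ℝ) (hε' : 0 ≤ ε') (h : ProkhorovLe P Q ε) (hlt : ε < ε')
    (f : (Fin k → ℝ) → ℝ) (hf : Measurable f) (ℓ B : ℝ) (hℓ : 0 ≤ ℓ) (hB : 0 ≤ B)
    (hosc : ∀ t t', f t - f t' ≤ B) (hlip : ∀ t t', f t - f t' ≤ ℓ * ∑ j, |t j - t' j|) :
    ∫ t, f t ∂P ≤ ∫ t, f t ∂Q + (ℓ + B) * ε' := by
  -- normalise
  obtain ⟨a, ha0, haB⟩ : ∃ a, (∀ t, 0 ≤ f t - a) ∧ ∀ t, f t - a ≤ B := by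
    refine ⟨⨅ t, f t, fun t => ?_, fun t => ?_⟩
    · have : BddBelow (range f) := ⟨f 0 - B, by rintro _ ⟨t, rfl⟩; linarith [hosc 0 t]⟩
      linarith [ciInf_le this t]
    · have : f t - B ≤ ⨅ t, f t := le_ciInf fun t' => by linarith [hosc t t']
      linarith
  set g : (Fin k → ℝ) → ℝ := fun t => f t - a with hg
  have hgm : Measurable g := hf.sub_const a
  have hfi : ∀ ν : Measure (Fin k → ℝ), IsProbabilityMeasure ν → Integrable g ν := by
    intro ν _
    refine Integrable.of_bound hgm.aestronglyMeasurable B (Filter.Eventually.of_forall fun t => ?_)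
    rw [Real.norm_eq_abs, abs_of_nonneg (ha0 t)]; exact haB t
  have hff : ∀ ν : Measure (Fin k → ℝ), IsProbabilityMeasure ν →
      ∫ t, f t ∂ν = ∫ t, g t ∂ν + a := by
    intro ν hν
    have : ∀ t, f t = g t + a := fun t => by simp [hg]
    simp_rw [this]
    rw [integral_add (hfi ν hν) (integrable_const a)]; simp
  rw [hff P inferInstance, hff Q inferInstance]
  suffices H : ∫ t, g t ∂P ≤ ∫ t, (g t + ℓ * ε') ∂Q + B * ε' by
    rw [integral_add (hfi Q inferInstance) (integrable_const _)] at H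
    simp at H; linarith
  have hc : 0 ≤ ℓ * ε' := by positivity
  have hi2 : Integrable (fun t => g t + ℓ * ε') Q := (hfi Q inferInstance).add (integrable_const _)
  have key : ∫⁻ t, ENNReal.ofReal (g t) ∂P ≤
      ∫⁻ t, ENNReal.ofReal (g t + ℓ * ε') ∂Q + ENNReal.ofReal (B * ε') := by
    rw [lintegral_eq_lintegral_meas_lt P (Filter.Eventually.of_forall ha0) hgm.aemeasurable,
      lintegral_eq_lintegral_meas_lt Q
        (Filter.Eventually.of_forall fun t => add_nonneg (ha0 t) hc)
        (hgm.add_const _).aemeasurable]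
    have h1 : ∀ y ∈ Ioi (0:ℝ), P {t | y < g t} ≤ Q {t | y < g t + ℓ * ε'} +
        (Ioo 0 B).indicator (fun _ => ENNReal.ofReal ε') y := by
      intro y hy
      by_cases hyB : y < B
      · rw [indicator_of_mem (show y ∈ Ioo 0 B from ⟨hy, hyB⟩)]
        refine ((h ε' hlt {t | y < g t} (measurableSet_lt measurable_const hgm)).1).trans ?_
        gcongr
        rename_i x
        rintro ⟨z, hz, hxz⟩
        have hz' : y < g z := hz
        have : g z - g x ≤ ℓ * ε' := by
          have h2 := hlip z x
          have h3 : ∑ j, |z j - x j| = ∑ j, |x j - z j| := by simp_rw [abs_sub_comm]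
          rw [h3] at h2
          simp only [hg]
          nlinarith
        show y < g x + ℓ * ε'
        linarith
      · have : {t | y < g t} = ∅ := by
          ext t; simp only [Set.mem_ofPred_eq, mem_empty_iff_false, iff_false, not_lt]
          exact (haB t).trans (not_lt.mp hyB)
        rw [this]; simp
    refine (setLIntegral_mono' measurableSet_Ioi h1).trans ?_
    rw [lintegral_add_right _ (measurable_const.indicator measurableSet_Ioo)]
    gcongr
    refine (setLIntegral_le_lintegral _ _).trans ?_
    rw [lintegral_indicator measurableSet_Ioo]
    simp [mul_comm B, ENNReal.ofReal_mul hε']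
  rw [← ofReal_integral_eq_lintegral_ofReal (hfi P inferInstance) (Filter.Eventually.of_forall ha0),
    ← ofReal_integral_eq_lintegral_ofReal hi2
      (Filter.Eventually.of_forall fun t => add_nonneg (ha0 t) hc),
    ← ENNReal.ofReal_add (integral_nonneg fun t => add_nonneg (ha0 t) hc) (by positivity)] at key
  exact (ENNReal.ofReal_le_ofReal_iff (add_nonneg (integral_nonneg fun t => add_nonneg (ha0 t) hc)
    (by positivity))).1 key

end MultiItem

open MeasureTheory Set
namespace MultiItem

noncomputable def lse {K : Type*} [Fintype K] (τ : ℝ) (x : K → ℝ) : ℝ :=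
  τ * Real.log (∑ k, Real.exp (x k / τ))

noncomputable def sm {K : Type*} [Fintype K] (τ : ℝ) (x : K → ℝ) (k : K) : ℝ :=
  Real.exp (x k / τ) / ∑ k, Real.exp (x k / τ)

section lse
variable {K : Type*} [Fintype K] [Nonempty K] {τ : ℝ}

theorem lse_den_pos (x : K → ℝ) : 0 < ∑ k, Real.exp (x k / τ) :=
  Finset.sum_pos (fun _ _ => Real.exp_pos _) Finset.univ_nonempty

theorem sm_nonneg (x : K → ℝ) (k : K) : 0 ≤ sm τ x k :=
  div_nonneg (Real.exp_pos _).le (lse_den_pos x).le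

theorem sm_sum (x : K → ℝ) : ∑ k, sm τ x k = 1 := by
  unfold sm; rw [← Finset.sum_div, div_self (lse_den_pos x).ne']

theorem lse_grad (hτ : 0 < τ) (x y : K → ℝ) :
    lse τ x + ∑ k, sm τ x k * (y k - x k) ≤ lse τ y := by
  have hx := lse_den_pos (τ := τ) x
  have hy := lse_den_pos (τ := τ) y
  have h1 := convexOn_exp.map_sum_le (t := Finset.univ) (w := sm τ x)
    (p := fun k => (y k - x k) / τ) (fun k _ => sm_nonneg x k) (sm_sum x) (fun _ _ => mem_univ _)
  simp only [smul_eq_mul] at h1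
  have h2 : ∑ k, sm τ x k * Real.exp ((y k - x k) / τ) =
      (∑ k, Real.exp (y k / τ)) / ∑ k, Real.exp (x k / τ) := by
    rw [Finset.sum_div]
    refine Finset.sum_congr rfl fun k _ => ?_
    unfold sm
    rw [div_mul_eq_mul_div, ← Real.exp_add]
    congr 2; ring
  rw [h2] at h1
  have h3 := Real.log_le_log (Real.exp_pos _) h1
  rw [Real.log_exp, Real.log_div hy.ne' hx.ne'] at h3
  have h4 : ∑ k, sm τ x k * ((y k - x k) / τ) = (∑ k, sm τ x k * (y k - x k)) / τ := by
    rw [Finset.sum_div]; exact Finset.sum_congr rfl fun k _ => by ring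
  rw [h4, div_le_iff₀ hτ] at h3
  unfold lse
  linarith

theorem le_lse (hτ : 0 < τ) (x : K → ℝ) (k : K) : x k ≤ lse τ x := by
  have : Real.exp (x k / τ) ≤ ∑ k, Real.exp (x k / τ) :=
    Finset.single_le_sum (f := fun k => Real.exp (x k / τ)) (fun _ _ => (Real.exp_pos _).le)
      (Finset.mem_univ k)
  have h3 := Real.log_le_log (Real.exp_pos _) this
  rw [Real.log_exp, div_le_iff₀ hτ] at h3
  unfold lse; linarith

theorem lse_le (hτ : 0 < τ) (x : K → ℝ) :
    lse τ x ≤ ∑ k, sm τ x k * x k + τ * Real.log (Fintype.card K) := by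
  have h := lse_grad hτ x 0
  have h0 : lse τ (0 : K → ℝ) = τ * Real.log (Fintype.card K) := by simp [lse]
  rw [h0] at h
  simp only [Pi.zero_apply, zero_sub, mul_neg, Finset.sum_neg_distrib] at h
  linarith

theorem lse_le_of_le (hτ : 0 < τ) (x y : K → ℝ) (c : ℝ) (h : ∀ k, x k - y k ≤ c) :
    lse τ x ≤ lse τ y + c := by
  have h1 := lse_grad hτ x y
  have h2 : ∑ k, sm τ x k * (x k - y k) ≤ ∑ k, sm τ x k * c :=
    Finset.sum_le_sum fun k _ => mul_le_mul_of_nonneg_left (h k) (sm_nonneg x k)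
  rw [← Finset.sum_mul, sm_sum, one_mul] at h2
  have h3 : ∑ k, sm τ x k * (x k - y k) = - ∑ k, sm τ x k * (y k - x k) := by
    rw [← Finset.sum_neg_distrib]; exact Finset.sum_congr rfl fun k _ => by ring
  linarith

theorem sm_perturb [DecidableEq K] (hτ : 0 < τ) (x : K → ℝ) (k : K) (h : ℝ) (hh : 0 ≤ h) :
    Real.exp (-(h / τ)) * sm τ x k ≤ sm τ (fun l => x l - if l = k then h else 0) k := by
  unfold sm
  simp only [if_true]
  rw [mul_div_assoc', ← Real.exp_add]
  have : -(h / τ) + x k / τ = (x k - h) / τ := by ring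
  rw [this]
  apply div_le_div_of_nonneg_left (Real.exp_pos _).le (lse_den_pos _)
  refine Finset.sum_le_sum fun l _ => Real.exp_le_exp.2 ?_
  apply div_le_div_of_nonneg_right _ hτ.le
  split_ifs <;> linarith

theorem measurable_lse {α : Type*} [MeasurableSpace α] (x : α → K → ℝ)
    (hx : ∀ k, Measurable fun t => x t k) : Measurable fun t => lse τ (x t) := by
  unfold lse
  exact ((Finset.measurable_sum _ fun k _ => ((hx k).div_const τ).exp).log).const_mul τ

theorem measurable_sm {α : Type*} [MeasurableSpace α] (x : α → K → ℝ)
    (hx : ∀ k, Measurable fun t => x t k) (k : K) : Measurable fun t => sm τ (x t) k := by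
  unfold sm
  exact ((hx k).div_const τ).exp.div (Finset.measurable_sum _ fun k _ => ((hx k).div_const τ).exp)

end lse

theorem ot_pos {α : Type*} [MeasurableSpace α] (μ : Measure α) [IsProbabilityMeasure μ]
    {K : Type*} [Fintype K] [Nonempty K] [DecidableEq K] (w : α → K → ℝ)
    (hw : ∀ k, Measurable fun t => w t k) (W : ℝ) (hW : ∀ t k, |w t k| ≤ W)
    (σ : K → ℝ) (hσ : ∀ k, 0 < σ k) (hσ1 : ∑ k, σ k = 1) (τ : ℝ) (hτ : 0 < τ) :
    ∃ φ : K → ℝ, ∀ k, ∫ t, sm τ (fun l => w t l - φ l) k ∂μ = σ k := by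
  classical
  set F : (K → ℝ) → α → ℝ := fun φ t => lse τ (fun l => w t l - φ l) with hF
  set g : (K → ℝ) → ℝ := fun φ => ∫ t, F φ t ∂μ + ∑ k, σ k * φ k with hg
  have hxm : ∀ φ : K → ℝ, ∀ k, Measurable fun t => w t k - φ k := fun φ k => (hw k).sub_const _
  have hFm : ∀ φ, Measurable (F φ) := fun φ => measurable_lse _ (hxm φ)
  have hFi : ∀ φ, Integrable (F φ) μ := by
    intro φ
    have hb : ∀ t, |F φ t| ≤ |lse τ (fun l => - φ l)| + W := by
      intro t
      have h1 := lse_le_of_le hτ (fun l => w t l - φ l) (fun l => - φ l) W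
        (fun k => by linarith [(abs_le.1 (hW t k)).2])
      have h2 := lse_le_of_le hτ (fun l => - φ l) (fun l => w t l - φ l) W
        (fun k => by linarith [(abs_le.1 (hW t k)).1])
      have h3 := abs_le.1 (le_refl |lse τ (fun l => - φ l)|)
      simp only [hF]
      rw [abs_le]; constructor <;> linarith
    exact Integrable.of_bound (hFm φ).aestronglyMeasurable _ (Filter.Eventually.of_forall hb)
  have hqi : ∀ (φ : K → ℝ) (k : K), Integrable (fun t => sm τ (fun l => w t l - φ l) k) μ := by
    intro φ k
    refine Integrable.of_bound (measurable_sm _ (hxm φ) k).aestronglyMeasurable 1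
      (Filter.Eventually.of_forall fun t => ?_)
    rw [Real.norm_eq_abs, abs_of_nonneg (sm_nonneg _ _), ← sm_sum (τ := τ) (fun l => w t l - φ l)]
    exact Finset.single_le_sum (f := fun k => sm τ (fun l => w t l - φ l) k)
      (fun _ _ => sm_nonneg _ _) (Finset.mem_univ k)
  -- comparison
  have hcmp : ∀ φ ψ : K → ℝ, ∀ c, (∀ k, ψ k - φ k ≤ c) → ∫ t, F φ t ∂μ ≤ ∫ t, F ψ t ∂μ + c := by
    intro φ ψ c h
    have : ∫ t, F φ t ∂μ ≤ ∫ t, (F ψ t + c) ∂μ := by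
      apply integral_mono (hFi φ) ((hFi ψ).add (integrable_const c))
      intro t
      exact lse_le_of_le hτ _ _ c fun k => by linarith [h k]
    rw [integral_add (hFi ψ) (integrable_const c)] at this
    simpa using this
  have hgc : Continuous g := by
    refine (LipschitzWith.of_le_add_mul 2 (f := g) fun φ ψ => ?_).continuous
    have hd : ∀ k, |ψ k - φ k| ≤ dist φ ψ := fun k => by
      rw [abs_sub_comm, ← Real.dist_eq]; exact dist_le_pi_dist φ ψ k
    have h1 := hcmp φ ψ (dist φ ψ) fun k => (le_abs_self _).trans (hd k)
    have h2 : ∑ k, σ k * φ k ≤ ∑ k, (σ k * ψ k + σ k * dist φ ψ) := by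
      refine Finset.sum_le_sum fun k _ => ?_
      have := (abs_le.1 (hd k)).1
      nlinarith [hσ k]
    rw [Finset.sum_add_distrib, ← Finset.sum_mul, hσ1] at h2
    simp only [hg]; push_cast; linarith
  -- shift invariance
  have hshift : ∀ φ : K → ℝ, ∀ c, g (fun k => φ k - c) ≤ g φ := by
    intro φ c
    have h1 := hcmp (fun k => φ k - c) φ c fun k => by simp
    have h2 : ∑ k, σ k * (φ k - c) = ∑ k, σ k * φ k - c := by
      simp_rw [mul_sub, Finset.sum_sub_distrib, ← Finset.sum_mul, hσ1, one_mul]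
    simp only [hg]; rw [h2]; linarith
  set R : ℝ := ∑ k, (|g 0| + W + 1) / σ k with hR
  have hW0 : 0 ≤ W := by
    obtain ⟨t⟩ : Nonempty α := by
      by_contra hne
      rw [not_nonempty_iff] at hne
      have := measure_univ (μ := μ)
      simp [Subsingleton.elim μ 0] at this
    exact (abs_nonneg _).trans (hW t (Classical.arbitrary K))
  have hterm : ∀ k, 0 ≤ (|g 0| + W + 1) / σ k := fun k =>
    div_nonneg (by positivity) (hσ k).le
  have hR0 : 0 ≤ R := Finset.sum_nonneg fun k _ => hterm k
  obtain ⟨φ, hφC, hφ⟩ := (isCompact_Icc (a := (0 : K → ℝ)) (b := fun _ => R)).exists_isMinOn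
    ⟨0, by simp [Pi.le_def], fun _ => hR0⟩ hgc.continuousOn
  have hmin : ∀ ψ, g φ ≤ g ψ := by
    intro ψ
    obtain ⟨k0, hk0⟩ := Finite.exists_min ψ
    set ψ' : K → ℝ := fun k => ψ k - ψ k0 with hψ'
    refine le_trans ?_ (hshift ψ (ψ k0))
    change g φ ≤ g ψ'
    have hψ0 : ∀ k, 0 ≤ ψ' k := fun k => by simp [hψ', hk0 k]
    by_cases hC : ∀ k, ψ' k ≤ R
    · exact hφ ⟨hψ0, hC⟩
    · push Not at hC
      obtain ⟨k, hk⟩ := hC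
      have h0 : g φ ≤ g 0 := hφ ⟨le_refl _, fun _ => hR0⟩
      refine h0.trans ?_
      have h1 : -W ≤ ∫ t, F ψ' t ∂μ := by
        have : ∫ _, (-W) ∂μ ≤ ∫ t, F ψ' t ∂μ := by
          apply integral_mono (integrable_const _) (hFi _)
          intro t
          have := le_lse hτ (fun l => w t l - ψ' l) k0
          simp only [hψ', sub_self, sub_zero] at this
          simp only [hF, hψ']
          linarith [(abs_le.1 (hW t k0)).1]
        simpa using this
      have h2 : σ k * ψ' k ≤ ∑ k, σ k * ψ' k :=
        Finset.single_le_sum (f := fun k => σ k * ψ' k)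
          (fun k _ => mul_nonneg (hσ k).le (hψ0 k)) (Finset.mem_univ k)
      have h3 : (|g 0| + W + 1) / σ k ≤ R :=
        Finset.single_le_sum (f := fun k => (|g 0| + W + 1) / σ k) (fun k _ => hterm k)
          (Finset.mem_univ k)
      have h4 : |g 0| + W + 1 ≤ σ k * ψ' k := by
        have := h3.trans hk.le
        rw [div_le_iff₀ (hσ k)] at this; linarith
      have : g ψ' = ∫ t, F ψ' t ∂μ + ∑ k, σ k * ψ' k := rfl
      rw [this]
      linarith [le_abs_self (g 0)]
  refine ⟨φ, ?_⟩
  have hle : ∀ k, ∫ t, sm τ (fun l => w t l - φ l) k ∂μ ≤ σ k := by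
    intro k
    have hh : ∀ h : ℝ, 0 < h →
        Real.exp (-(h / τ)) * ∫ t, sm τ (fun l => w t l - φ l) k ∂μ ≤ σ k := by
      intro h hpos
      set ψ : K → ℝ := fun l => φ l + if l = k then h else 0 with hψ
      have h1 := hmin ψ
      have h2 : ∫ t, F ψ t ∂μ ≤ ∫ t, (F φ t - h * (sm τ (fun l => w t l - ψ l) k)) ∂μ := by
        apply integral_mono (hFi _) ((hFi _).sub ((hqi ψ k).const_mul h))
        intro t
        have := lse_grad hτ (fun l => w t l - ψ l) (fun l => w t l - φ l)
        have h5 : ∀ l, sm τ (fun l => w t l - ψ l) l * (w t l - φ l - (w t l - ψ l)) =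
            if l = k then h * sm τ (fun l => w t l - ψ l) k else 0 := by
          intro l
          simp only [hψ]
          split_ifs with hl
          · subst hl; ring
          · ring
        simp only [h5, Finset.sum_ite_eq', Finset.mem_univ, if_true] at this
        simp only [hF, Pi.sub_apply]
        linarith
      rw [integral_sub (hFi _) ((hqi ψ k).const_mul h), integral_const_mul] at h2
      have h3 : ∑ l, σ l * ψ l = ∑ l, σ l * φ l + h * σ k := by
        simp only [hψ, mul_add, Finset.sum_add_distrib, mul_ite, mul_zero, Finset.sum_ite_eq',
          Finset.mem_univ, if_true]; ring
      have h4 : ∫ t, sm τ (fun l => w t l - ψ l) k ∂μ ≤ σ k := by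
        simp only [hg] at h1
        rw [h3] at h1
        have : h * ∫ t, sm τ (fun l => w t l - ψ l) k ∂μ ≤ h * σ k := by linarith
        exact le_of_mul_le_mul_left this hpos
      refine le_trans ?_ h4
      rw [← integral_const_mul]
      apply integral_mono ((hqi φ k).const_mul _) (hqi ψ k)
      intro t
      have := sm_perturb hτ (fun l => w t l - φ l) k h hpos.le
      refine this.trans (le_of_eq ?_)
      simp only [hψ]
      congr 1; ext l; ring
    have hlim : Filter.Tendsto (fun h : ℝ => Real.exp (-(h / τ)) *
        ∫ t, sm τ (fun l => w t l - φ l) k ∂μ) (nhdsWithin 0 (Ioi 0))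
        (nhds (Real.exp (-(0 / τ)) * ∫ t, sm τ (fun l => w t l - φ l) k ∂μ)) := by
      apply Filter.Tendsto.mono_left _ nhdsWithin_le_nhds
      apply Continuous.tendsto
      fun_prop
    have := le_of_tendsto hlim (by
      filter_upwards [self_mem_nhdsWithin] with h hh'
      exact hh h hh')
    simpa using this
  have hsum : ∑ k, ∫ t, sm τ (fun l => w t l - φ l) k ∂μ = ∑ k, σ k := by
    rw [← integral_finsetSum _ fun k _ => hqi φ k]
    simp [sm_sum, hσ1]
  intro k
  exact (Finset.sum_eq_sum_iff_of_le fun k _ => hle k).1 hsum k (Finset.mem_univ k)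

/-- Transport lemma with zero masses allowed. -/
theorem ot_gen {α : Type*} [MeasurableSpace α] (μ : Measure α) [IsProbabilityMeasure μ]
    {K : Type*} [Fintype K] [DecidableEq K] (w : α → K → ℝ)
    (hw : ∀ k, Measurable fun t => w t k) (W : ℝ) (hW : ∀ t k, |w t k| ≤ W)
    (σ : K → ℝ) (hσ : ∀ k, 0 ≤ σ k) (hσ1 : ∑ k, σ k = 1) (k0 : K) (hk0 : 0 < σ k0)
    (τ : ℝ) (hτ : 0 < τ) :
    ∃ (φ : K → ℝ) (U : α → ℝ) (q : α → K → ℝ), φ k0 = 0 ∧ Measurable U ∧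
      (∀ k, Measurable fun t => q t k) ∧ (∀ t k, 0 ≤ q t k) ∧ (∀ t, ∑ k, q t k = 1) ∧
      (∀ k, ∫ t, q t k ∂μ = σ k) ∧ (∀ t k, σ k = 0 → q t k = 0) ∧
      (∀ t k, 0 < σ k → w t k - φ k ≤ U t) ∧
      (∀ t t', U t' + ∑ k, q t' k * (w t k - w t' k) ≤ U t) ∧
      (∀ t, U t ≤ ∑ k, q t k * (w t k - φ k) + τ) := by
  classical
  set S := {k : K // 0 < σ k} with hS
  have : Nonempty S := ⟨⟨k0, hk0⟩⟩
  -- sums over K vs S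
  have hsumS : ∀ f : K → ℝ, (∀ k, σ k = 0 → f k = 0) → ∑ k, f k = ∑ s : S, f s := by
    intro f hf
    have h1 : ∑ k, f k = ∑ k ∈ Finset.univ.filter (fun k => 0 < σ k), f k := by
      rw [Finset.sum_filter_of_ne]
      intro k _ hk
      exact lt_of_le_of_ne (hσ k) fun h => hk (hf k h.symm)
    rw [h1]
    exact Finset.sum_subtype _ (by simp) f
  set c : ℝ := Real.log (Fintype.card S) + 1 with hc
  have hcpos : 0 < c := by
    have : 0 ≤ Real.log (Fintype.card S) := Real.log_natCast_nonneg _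
    linarith
  set τ' := τ / c with hτ'
  have hτ'0 : 0 < τ' := div_pos hτ hcpos
  have hτ'1 : τ' * Real.log (Fintype.card S) ≤ τ := by
    rw [hτ', div_mul_eq_mul_div, div_le_iff₀ hcpos]; nlinarith
  obtain ⟨φ0, hφ0⟩ := ot_pos μ (fun t (s : S) => w t s) (fun s => hw s) W (fun t s => hW t s)
    (fun s => σ s) (fun s => s.2) (by rw [← hsumS σ (fun _ h => h)]; exact hσ1) τ' hτ'0
  set φ1 : S → ℝ := fun s => φ0 s - φ0 ⟨k0, hk0⟩ with hφ1
  have hsm : ∀ (x : S → ℝ) (a : ℝ) s, sm τ' (fun l => x l + a) s = sm τ' x s := by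
    intro x a s
    unfold sm
    simp_rw [add_div, Real.exp_add, ← Finset.sum_mul]
    rw [mul_div_mul_right _ _ (Real.exp_pos _).ne']
  have hφ1' : ∀ s, ∫ t, sm τ' (fun l : S => w t l - φ1 l) s ∂μ = σ s := by
    intro s
    rw [← hφ0 s]
    congr 1; ext t
    rw [← hsm (fun l : S => w t l - φ0 l) (φ0 ⟨k0, hk0⟩)]
    congr 1; ext l; simp only [hφ1]; ring
  have hxm : ∀ k : S, Measurable fun t => w t k - φ1 k := fun k => (hw k).sub_const _
  set q : α → K → ℝ := fun t k =>
    if h : 0 < σ k then sm τ' (fun l : S => w t l - φ1 l) ⟨k, h⟩ else 0 with hq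
  have hq0 : ∀ t k, σ k = 0 → q t k = 0 := fun t k h => by simp [hq, h]
  have hqS : ∀ t (s : S), q t s = sm τ' (fun l : S => w t l - φ1 l) s := fun t s => by
    simp [hq, s.2]
  refine ⟨fun k => if h : 0 < σ k then φ1 ⟨k, h⟩ else 0,
    fun t => lse τ' (fun l : S => w t l - φ1 l), q, by simp [hφ1], measurable_lse _ hxm, ?_, ?_, ?_,
    ?_, hq0, ?_, ?_, ?_⟩
  · intro k
    by_cases h : 0 < σ k
    · simp only [hq, h, dif_pos]; exact measurable_sm _ hxm _
    · simp [hq, h]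
  · intro t k
    simp only [hq]; split_ifs
    · exact sm_nonneg _ _
    · exact le_rfl
  · intro t
    rw [hsumS _ (hq0 t)]
    simp_rw [hqS]; exact sm_sum _
  · intro k
    by_cases h : 0 < σ k
    · simp only [hq, h, dif_pos]; exact hφ1' ⟨k, h⟩
    · have : σ k = 0 := le_antisymm (not_lt.1 h) (hσ k)
      simp [hq, this]
  · intro t k h
    simp only [h, dif_pos]
    exact le_lse hτ'0 (fun l : S => w t l - φ1 l) ⟨k, h⟩
  · intro t t'
    rw [hsumS _ (fun k h => by rw [hq0 t' k h, zero_mul])]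
    have := lse_grad hτ'0 (fun l : S => w t' l - φ1 l) (fun l : S => w t l - φ1 l)
    simp_rw [hqS]
    refine le_trans (le_of_eq ?_) this
    congr 1
    refine Finset.sum_congr rfl fun k _ => ?_
    ring
  · intro t
    rw [hsumS _ (fun k h => by rw [hq0 t k h, zero_mul])]
    have := lse_le hτ'0 (fun l : S => w t l - φ1 l)
    simp_rw [hqS]
    have h2 : ∀ s : S, (if h : 0 < σ s then φ1 ⟨s, h⟩ else 0) = φ1 s := fun s => by simp [s.2]
    simp_rw [h2]
    linarith

end MultiItem

open MeasureTheory Set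
namespace MultiItem

theorem measurable_some {α : Type*} [MeasurableSpace α] : Measurable (some : α → Option α) :=
  fun _ hs => hs

theorem measurable_option {α β : Type*} [MeasurableSpace α] [MeasurableSpace β]
    (f : Option α → β) (hf : Measurable fun a => f (some a)) : Measurable f :=
  fun _ hs => hf hs

theorem key_prod {n : ℕ} {α : Type*} [MeasurableSpace α] {J : Type*} [Fintype J] [DecidableEq J]
    (D : Fin n → Measure α) [∀ i, IsProbabilityMeasure (D i)]
    (q : Fin n → α → J → ℝ) (hqm : ∀ i j, Measurable fun t => q i t j)
    (hq0 : ∀ i t j, 0 ≤ q i t j) (hq1 : ∀ i t j, q i t j ≤ 1)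
    (A : (Fin n → J) → ℝ) (i : Fin n) (g : α → J → ℝ) (hgm : ∀ j, Measurable fun t => g t j)
    (G : ℝ) (hgG : ∀ t j, |g t j| ≤ G) :
    Integrable (fun b : Fin n → α =>
      ∑ k : Fin n → J, g (b i) (k i) * (∏ l ∈ Finset.univ.erase i, q l (b l) (k l)) * A k)
      (Measure.pi D) ∧
    ∫ b, ∑ k : Fin n → J, g (b i) (k i) * (∏ l ∈ Finset.univ.erase i, q l (b l) (k l)) * A k
        ∂(Measure.pi D) =
      ∑ j, (∫ t, g t j ∂(D i)) * ∑ k : Fin n → J, if k i = j then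
        (∏ l ∈ Finset.univ.erase i, ∫ t, q l t (k l) ∂(D l)) * A k else 0 := by
  have hi : ∀ k : Fin n → J, Integrable (fun b : Fin n → α =>
      g (b i) (k i) * (∏ l ∈ Finset.univ.erase i, q l (b l) (k l)) * A k) (Measure.pi D) := by
    intro k
    refine Integrable.of_bound (C := G * 1 * |A k|) ?_ (Filter.Eventually.of_forall fun b => ?_)
    · refine Measurable.aestronglyMeasurable ?_
      refine (Measurable.mul ((hgm (k i)).comp (measurable_pi_apply i)) ?_).mul_const _
      exact Finset.measurable_prod _ fun l _ => (hqm l (k l)).comp (measurable_pi_apply l)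
    · rw [Real.norm_eq_abs, abs_mul, abs_mul]
      have h1 : 0 ≤ ∏ l ∈ Finset.univ.erase i, q l (b l) (k l) :=
        Finset.prod_nonneg fun l _ => hq0 _ _ _
      have h2 : ∏ l ∈ Finset.univ.erase i, q l (b l) (k l) ≤ 1 :=
        Finset.prod_le_one (fun l _ => hq0 _ _ _) fun l _ => hq1 _ _ _
      rw [abs_of_nonneg h1]
      have hG := hgG (b i) (k i)
      have : 0 ≤ G := (abs_nonneg _).trans hG
      gcongr
  refine ⟨integrable_finsetSum _ fun k _ => hi k, ?_⟩
  rw [integral_finsetSum _ fun k _ => hi k]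
  have h1 : ∀ k : Fin n → J, ∫ b, g (b i) (k i) *
      (∏ l ∈ Finset.univ.erase i, q l (b l) (k l)) * A k ∂(Measure.pi D) =
      (∫ t, g t (k i) ∂(D i)) * ((∏ l ∈ Finset.univ.erase i, ∫ t, q l t (k l) ∂(D l)) * A k) := by
    intro k
    rw [integral_mul_const, ← mul_assoc]
    congr 1
    have h2 := integral_fintype_prod_eq_prod (𝕜 := ℝ) (μ := D)
      (fun l t => if l = i then g t (k i) else q l t (k l))
    have h3 : ∀ b : Fin n → α, (∏ l, if l = i then g (b l) (k i) else q l (b l) (k l)) =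
        g (b i) (k i) * ∏ l ∈ Finset.univ.erase i, q l (b l) (k l) := by
      intro b
      rw [← Finset.mul_prod_erase _ _ (Finset.mem_univ i)]
      simp only [if_true]
      congr 1
      refine Finset.prod_congr rfl fun l hl => ?_
      rw [if_neg (Finset.ne_of_mem_erase hl)]
    simp_rw [h3] at h2
    rw [h2, ← Finset.mul_prod_erase _ _ (Finset.mem_univ i)]
    simp only [if_true]
    congr 1
    refine Finset.prod_congr rfl fun l hl => ?_
    simp [Finset.ne_of_mem_erase hl]
  simp_rw [h1, Finset.mul_sum]
  rw [Finset.sum_comm]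
  refine Finset.sum_congr rfl fun k _ => ?_
  rw [Finset.sum_eq_single (k i)]
  · simp
  · intro j _ hj; simp [hj.symm]
  · simp

theorem mech_exists {n m : ℕ} (H : ℝ) (v : Fin n → (Fin m → ℝ) → Alloc n m → ℝ) (B : ℝ)
    (hv0 : ∀ i t x, 0 ≤ v i t x) (hvB : ∀ i t x, v i t x ≤ B)
    (hvm : ∀ i x, Measurable fun t => v i t x)
    {J : Type} [Fintype J] [DecidableEq J]
    (D : Fin n → Measure (Fin m → ℝ)) [∀ i, IsProbabilityMeasure (D i)]
    (q : Fin n → (Fin m → ℝ) → J → ℝ) (hqm : ∀ i j, Measurable fun t => q i t j)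
    (hq0 : ∀ i t j, 0 ≤ q i t j) (hq1 : ∀ i t, ∑ j, q i t j = 1)
    (A : (Fin n → J) → Alloc n m → ℝ) (hA0 : ∀ k x, 0 ≤ A k x) (hA1 : ∀ k, ∑ x, A k x = 1)
    (U : Fin n → (Fin m → ℝ) → ℝ) (hUm : ∀ i, Measurable (U i)) (hU0 : ∀ i t, 0 ≤ U i t)
    (W : ℝ) (hUW : ∀ i t, U i t ≤ W)
    (a : Fin n → J → Alloc n m → ℝ)
    (ha : ∀ i j x, a i j x = ∑ k : Fin n → J, if k i = j then
        (∏ l ∈ Finset.univ.erase i, ∫ t, q l t (k l) ∂(D l)) * A k x else 0)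
    (hIC : ∀ i t t', U i t' + ∑ j, q i t' j * ∑ x, a i j x *
      ((v i t x - v i t (emptyAlloc n m)) - (v i t' x - v i t' (emptyAlloc n m))) ≤ U i t) :
    ∃ M : Mechanism n m, IsIR H v M ∧ IsBIC 0 H v M D ∧
      RevT M D = ∑ i, ∫ t, ((∑ j, q i t j * ∑ x, a i j x *
        (v i t x - v i t (emptyAlloc n m))) - U i t) ∂(D i) := by
  classical
  set F : (Fin n → Fin m → ℝ) → Alloc n m → ℝ := fun s x =>
    ∑ k : Fin n → J, (∏ i, q i (s i) (k i)) * A k x with hF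
  have hF0 : ∀ s x, 0 ≤ F s x := fun s x => Finset.sum_nonneg fun k _ =>
    mul_nonneg (Finset.prod_nonneg fun i _ => hq0 _ _ _) (hA0 _ _)
  have hF1 : ∀ s, ∑ x, F s x = 1 := by
    intro s
    simp only [hF]
    rw [Finset.sum_comm]
    simp_rw [← Finset.mul_sum, hA1, mul_one]
    rw [← Fintype.prod_sum fun i j => q i (s i) j]
    simp [hq1]
  have hFm : ∀ x, Measurable fun s => F s x := by
    intro x
    refine Finset.measurable_sum _ fun k _ => Measurable.mul_const ?_ _
    exact Finset.measurable_prod _ fun i _ => (hqm i (k i)).comp (measurable_pi_apply i)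
  have hqle : ∀ i t j, q i t j ≤ 1 := fun i t j => by
    rw [← hq1 i t]
    exact Finset.single_le_sum (f := fun j => q i t j) (fun _ _ => hq0 _ _ _) (Finset.mem_univ j)
  set T : (Fin n → Fin m → ℝ) → Fin n → ℝ := fun s i =>
    ∑ x, F s x * v i (s i) x - v i (s i) (emptyAlloc n m) - U i (s i) with hT
  have hTm : ∀ i, Measurable fun s => T s i := by
    intro i
    have hvi : ∀ x, Measurable fun s : Fin n → Fin m → ℝ => v i (s i) x := fun x =>
      (hvm i x).comp (measurable_pi_apply i)
    refine ((Finset.measurable_sum _ fun x _ => (hFm x).mul (hvi x)).sub (hvi _)).sub ?_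
    exact (hUm i).comp (measurable_pi_apply i)
  set d : (Fin n → Option (Fin m → ℝ)) → (Fin n → Fin m → ℝ) := fun b i => (b i).getD 0 with hd
  have hdm : Measurable d := by
    refine measurable_pi_lambda _ fun i => ?_
    exact (measurable_option (fun o : Option (Fin m → ℝ) => o.getD 0) measurable_id).comp
      (measurable_pi_apply i)
  have hnone : MeasurableSet {b : Fin n → Option (Fin m → ℝ) | ∃ i, b i = none} := by
    have : {b : Fin n → Option (Fin m → ℝ) | ∃ i, b i = none} =
        ⋃ i, (fun b : Fin n → Option (Fin m → ℝ) => b i) ⁻¹' {none} := by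
      ext b; simp
    rw [this]
    refine MeasurableSet.iUnion fun i => measurable_pi_apply i ?_
    show MeasurableSet ((some : (Fin m → ℝ) → Option (Fin m → ℝ)) ⁻¹' {none})
    have he : ((some : (Fin m → ℝ) → Option (Fin m → ℝ)) ⁻¹' {none}) = ∅ := by
      ext z; simp
    rw [he]; exact MeasurableSet.empty
  let M : Mechanism n m :=
    { allocProb := fun b x => if ∃ i, b i = none then (if x = emptyAlloc n m then 1 else 0)
        else F (d b) x
      pay := fun b i => if ∃ i, b i = none then 0 else T (d b) i
      allocProb_nonneg := by
        intro b x; split_ifs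
        · exact zero_le_one
        · exact le_rfl
        · exact hF0 _ _
      allocProb_sum_one := by
        intro b; split_ifs
        · simp
        · exact hF1 _
      optOut := by
        intro b hb
        constructor
        · ext x; simp only [if_pos hb]
        · ext x; simp only [if_pos hb]
      meas_allocProb := fun x => Measurable.ite hnone measurable_const ((hFm x).comp hdm)
      meas_pay := fun i => Measurable.ite hnone measurable_const ((hTm i).comp hdm) }
  have hMa : ∀ s x, M.allocProb (fun j => some (s j)) x = F s x := by
    intro s x
    show (if _ then _ else _) = _
    rw [if_neg (by simp)]; rfl
  have hMp : ∀ s i, M.pay (fun j => some (s j)) i = T s i := by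
    intro s i
    show (if _ then _ else _) = _
    rw [if_neg (by simp)]; rfl
  have hMn : ∀ b x, (∃ i, b i = none) → M.allocProb b x = if x = emptyAlloc n m then 1 else 0 := by
    intro b x hb
    show (if _ then _ else _) = _
    rw [if_pos hb]
  have hMpn : ∀ b i, (∃ i, b i = none) → M.pay b i = 0 := by
    intro b x hb
    show (if _ then _ else _) = _
    rw [if_pos hb]
  have hsplit : ∀ (s : Fin n → Fin m → ℝ) (i : Fin n) (k : Fin n → J), ∏ l, q l (s l) (k l) =
      q i (s i) (k i) * ∏ l ∈ Finset.univ.erase i, q l (s l) (k l) := fun s i k =>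
    (Finset.mul_prod_erase _ _ (Finset.mem_univ i)).symm
  -- interim allocation
  have hintg : ∀ i t' x,
      Integrable (fun b => F (Function.update b i t') x) (Measure.pi D) ∧
      ∫ b, F (Function.update b i t') x ∂(Measure.pi D) = ∑ j, q i t' j * a i j x := by
    intro i t' x
    have h := key_prod D q hqm hq0 hqle (fun k => A k x) i (fun _ j => q i t' j)
      (fun j => measurable_const) 1 (fun t j => by rw [abs_of_nonneg (hq0 _ _ _)]; exact hqle _ _ _)
    have h2 : ∀ b : Fin n → Fin m → ℝ, F (Function.update b i t') x =
        ∑ k : Fin n → J, q i t' (k i) * (∏ l ∈ Finset.univ.erase i, q l (b l) (k l)) * A k x := by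
      intro b
      simp only [hF]
      refine Finset.sum_congr rfl fun k _ => ?_
      rw [hsplit _ i k]
      simp only [Function.update_self]
      congr 2
      refine Finset.prod_congr rfl fun l hl => ?_
      rw [Function.update_of_ne (Finset.ne_of_mem_erase hl)]
    simp_rw [h2]
    refine ⟨h.1, h.2.trans ?_⟩
    simp_rw [ha]
    simp
  have hsa : ∀ i t', ∑ x, ∑ j, q i t' j * a i j x = 1 := by
    intro i t'
    simp_rw [← (hintg i t' _).2]
    rw [← integral_finsetSum _ fun x _ => (hintg i t' x).1]
    simp [hF1]
  refine ⟨M, ?_, ?_, ?_⟩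
  · intro t _ i
    unfold util
    simp_rw [hMa, hMp]
    simp only [hT]
    have := hv0 i (t i) (emptyAlloc n m)
    have := hU0 i (t i)
    linarith
  · intro i t _ bid _
    have hinterim : ∀ t', interim v M D i t (some t') =
        ∑ x, (∑ j, q i t' j * a i j x) * (v i t x - v i t' x) + v i t' (emptyAlloc n m) + U i t' := by
      intro t'
      unfold interim util
      have h1 : ∀ b : Fin n → Fin m → ℝ,
          (fun j => if j = i then some t' else some (b j)) =
          fun j => some (Function.update b i t' j) := by
        intro b; ext1 j
        by_cases hj : j = i
        · subst hj; simp
        · simp [hj]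
      simp_rw [h1, hMa, hMp]
      simp only [hT, Function.update_self]
      have h2 : ∀ b : Fin n → Fin m → ℝ, ∑ x, F (Function.update b i t') x * v i t x -
          (∑ x, F (Function.update b i t') x * v i t' x - v i t' (emptyAlloc n m) - U i t') =
          ∑ x, F (Function.update b i t') x * (v i t x - v i t' x) +
            (v i t' (emptyAlloc n m) + U i t') := by
        intro b
        simp_rw [mul_sub, Finset.sum_sub_distrib]; ring
      simp_rw [h2]
      have h3 : ∀ x, Integrable (fun b => F (Function.update b i t') x * (v i t x - v i t' x))
          (Measure.pi D) := fun x => (hintg i t' x).1.mul_const _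
      rw [integral_add (integrable_finsetSum _ fun x _ => h3 x) (integrable_const _),
        integral_finsetSum _ fun x _ => h3 x]
      simp_rw [integral_mul_const, (hintg i t' _).2]
      simp
      ring
    have htruth : interim v M D i t (some t) = v i t (emptyAlloc n m) + U i t := by
      rw [hinterim]; simp
    rw [htruth]
    rcases bid with _ | t'
    · unfold interim util
      have : ∀ b : Fin n → Fin m → ℝ, ∃ l, (fun j => if j = i then none else some (b j)) l = none :=
        fun b => ⟨i, by simp⟩
      simp_rw [hMn _ _ (this _), hMpn _ _ (this _)]
      simp [hU0 i t]
    · rw [hinterim]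
      have h := hIC i t t'
      have h4 : ∑ j, q i t' j * ∑ x, a i j x *
          ((v i t x - v i t (emptyAlloc n m)) - (v i t' x - v i t' (emptyAlloc n m))) =
          ∑ x, (∑ j, q i t' j * a i j x) * (v i t x - v i t' x) -
            (v i t (emptyAlloc n m) - v i t' (emptyAlloc n m)) := by
        have h5 : ∑ j, q i t' j * ∑ x, a i j x *
          ((v i t x - v i t (emptyAlloc n m)) - (v i t' x - v i t' (emptyAlloc n m))) =
          ∑ x, (∑ j, q i t' j * a i j x) *
            ((v i t x - v i t' x) - (v i t (emptyAlloc n m) - v i t' (emptyAlloc n m))) := by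
          simp_rw [Finset.mul_sum, Finset.sum_mul]
          rw [Finset.sum_comm]
          refine Finset.sum_congr rfl fun x _ => Finset.sum_congr rfl fun j _ => ?_
          ring
        rw [h5]
        simp_rw [mul_sub _ (v i t _ - v i t' _), Finset.sum_sub_distrib]
        rw [← Finset.sum_mul, hsa, one_mul]
      rw [h4] at h
      linarith
  · unfold RevT
    simp_rw [hMp]
    -- per bidder
    have hg : ∀ i x, Integrable (fun b : Fin n → Fin m → ℝ => F b x * v i (b i) x) (Measure.pi D) ∧
        ∫ b, F b x * v i (b i) x ∂(Measure.pi D) =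
          ∑ j, (∫ t, q i t j * v i t x ∂(D i)) * a i j x := by
      intro i x
      have h := key_prod D q hqm hq0 hqle (fun k => A k x) i (fun t j => q i t j * v i t x)
        (fun j => (hqm i j).mul (hvm i x)) B (fun t j => by
          rw [abs_of_nonneg (mul_nonneg (hq0 _ _ _) (hv0 _ _ _))]
          exact (mul_le_of_le_one_left (hv0 _ _ _) (hqle _ _ _)).trans (hvB _ _ _))
      have h2 : ∀ b : Fin n → Fin m → ℝ, F b x * v i (b i) x =
          ∑ k : Fin n → J, q i (b i) (k i) * v i (b i) x *
            (∏ l ∈ Finset.univ.erase i, q l (b l) (k l)) * A k x := by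
        intro b
        simp only [hF]
        rw [Finset.sum_mul]
        refine Finset.sum_congr rfl fun k _ => ?_
        rw [hsplit _ i k]; ring
      simp_rw [h2]
      refine ⟨h.1, h.2.trans ?_⟩
      simp_rw [ha]
    have hcomp : ∀ i (f : (Fin m → ℝ) → ℝ), Measurable f → (∃ C, ∀ t, |f t| ≤ C) →
        Integrable f (D i) ∧ Integrable (fun b : Fin n → Fin m → ℝ => f (b i)) (Measure.pi D) ∧
        ∫ b : Fin n → Fin m → ℝ, f (b i) ∂(Measure.pi D) = ∫ t, f t ∂(D i) := by
      rintro i f hf ⟨C, hC⟩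
      refine ⟨Integrable.of_bound hf.aestronglyMeasurable C (Filter.Eventually.of_forall hC),
        Integrable.of_bound (hf.comp (measurable_pi_apply i)).aestronglyMeasurable C
          (Filter.Eventually.of_forall fun b => hC _), ?_⟩
      have := (measurePreserving_eval D i).map_eq
      rw [← this, integral_map (measurable_pi_apply i).aemeasurable hf.aestronglyMeasurable]
    have hv' : ∀ i x, ∃ C, ∀ t, |v i t x| ≤ C := fun i x =>
      ⟨B, fun t => by rw [abs_of_nonneg (hv0 _ _ _)]; exact hvB _ _ _⟩
    have hU' : ∀ i, ∃ C, ∀ t, |U i t| ≤ C := fun i =>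
      ⟨W, fun t => by rw [abs_of_nonneg (hU0 _ _)]; exact hUW _ _⟩
    have hTi : ∀ i, Integrable (fun b => T b i) (Measure.pi D) := by
      intro i
      exact ((integrable_finsetSum _ fun x _ => (hg i x).1).sub
        (hcomp i _ (hvm i _) (hv' i _)).2.1).sub (hcomp i _ (hUm i) (hU' i)).2.1
    rw [integral_finsetSum _ fun i _ => hTi i]
    refine Finset.sum_congr rfl fun i _ => ?_
    have hqv : ∀ j x, Integrable (fun t => q i t j * v i t x) (D i) := fun j x =>
      (hcomp i (fun t => q i t j * v i t x) ((hqm i j).mul (hvm i x)) ⟨B, fun t => by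
          rw [abs_of_nonneg (mul_nonneg (hq0 _ _ _) (hv0 _ _ _))]
          exact (mul_le_of_le_one_left (hv0 _ _ _) (hqle _ _ _)).trans (hvB _ _ _)⟩).1
    have hve := (hcomp i _ (hvm i (emptyAlloc n m)) (hv' i _))
    have hUU := (hcomp i _ (hUm i) (hU' i))
    have e1 : ∫ b, T b i ∂(Measure.pi D) =
        ∑ x, ∑ j, (∫ t, q i t j * v i t x ∂(D i)) * a i j x -
        ∫ t, v i t (emptyAlloc n m) ∂(D i) - ∫ t, U i t ∂(D i) := by
      simp only [hT]
      have hA' : Integrable (fun b => ∑ x, F b x * v i (b i) x - v i (b i) (emptyAlloc n m))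
        (Measure.pi D) := (integrable_finsetSum _ fun x _ => (hg i x).1).sub hve.2.1
      rw [integral_sub hA' hUU.2.1,
        integral_sub (integrable_finsetSum _ fun x _ => (hg i x).1) hve.2.1,
        integral_finsetSum _ fun x _ => (hg i x).1, hve.2.2, hUU.2.2]
      simp_rw [(hg i _).2]
    have e2 : ∀ t, (∑ j, q i t j * ∑ x, a i j x * (v i t x - v i t (emptyAlloc n m))) - U i t =
        (∑ x, ∑ j, q i t j * v i t x * a i j x) - v i t (emptyAlloc n m) - U i t := by
      intro t
      congr 1
      have h5 : ∑ j, q i t j * ∑ x, a i j x * (v i t x - v i t (emptyAlloc n m)) =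
          ∑ x, ∑ j, (q i t j * v i t x * a i j x - q i t j * a i j x * v i t (emptyAlloc n m)) := by
        simp_rw [Finset.mul_sum]
        rw [Finset.sum_comm]
        refine Finset.sum_congr rfl fun x _ => Finset.sum_congr rfl fun j _ => ?_
        ring
      rw [h5]
      simp_rw [Finset.sum_sub_distrib, ← Finset.sum_mul]
      rw [hsa, one_mul]
    rw [e1]
    simp_rw [e2]
    have hs : Integrable (fun t => ∑ x, ∑ j, q i t j * v i t x * a i j x) (D i) :=
      integrable_finsetSum _ fun x _ => integrable_finsetSum _ fun j _ => (hqv j x).mul_const _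
    have hs2 : Integrable (fun t => ∑ x, ∑ j, q i t j * v i t x * a i j x -
      v i t (emptyAlloc n m)) (D i) := hs.sub hve.1
    rw [integral_sub hs2 hUU.1, integral_sub hs hve.1,
      integral_finsetSum _ fun x _ => integrable_finsetSum _ fun j _ => (hqv j x).mul_const _]
    congr 2
    refine Finset.sum_congr rfl fun x _ => ?_
    rw [integral_finsetSum _ fun j _ => (hqv j x).mul_const _]
    simp_rw [integral_mul_const]

end MultiItem

open MeasureTheory Set
namespace MultiItem

theorem update_mp {n : ℕ} {α : Type*} [MeasurableSpace α] (D : Fin n → Measure α)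
    [∀ i, IsProbabilityMeasure (D i)] (i : Fin n) :
    MeasurePreserving (fun p : α × (Fin n → α) => Function.update p.2 i p.1)
      ((D i).prod (Measure.pi D)) (Measure.pi D) := by
  have hm : Measurable (fun p : α × (Fin n → α) => Function.update p.2 i p.1) := by
    refine measurable_pi_lambda _ fun l => ?_
    by_cases hl : l = i
    · subst hl; simpa using measurable_fst
    · simp only [Function.update_of_ne hl]
      exact (measurable_pi_apply l).comp measurable_snd
  refine ⟨hm, ?_⟩
  symm
  refine Measure.pi_eq fun s hs => ?_
  rw [Measure.map_apply hm (MeasurableSet.univ_pi hs)]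
  have : (fun p : α × (Fin n → α) => Function.update p.2 i p.1) ⁻¹' (Set.univ.pi s) =
      (s i) ×ˢ (Set.univ.pi fun l => if l = i then Set.univ else s l) := by
    ext p
    simp only [Set.mem_preimage, Set.mem_univ_pi, Set.mem_prod]
    constructor
    · intro h
      refine ⟨by simpa using h i, fun l => ?_⟩
      by_cases hl : l = i
      · simp [hl]
      · simpa [hl] using h l
    · rintro ⟨h1, h2⟩ l
      by_cases hl : l = i
      · subst hl; simpa using h1
      · simpa [hl] using h2 l
  rw [this, Measure.prod_prod, Measure.pi_pi, ← Finset.mul_prod_erase _ _ (Finset.mem_univ i),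
    ← Finset.mul_prod_erase Finset.univ (fun l => (D l) (s l)) (Finset.mem_univ i)]
  simp only [if_true, measure_univ, one_mul]
  congr 1
  refine Finset.prod_congr rfl fun l hl => ?_
  rw [if_neg (Finset.ne_of_mem_erase hl)]

theorem update_fubini {n : ℕ} {α : Type*} [MeasurableSpace α] (D : Fin n → Measure α)
    [∀ i, IsProbabilityMeasure (D i)] (i : Fin n) (F : (Fin n → α) → ℝ)
    (hF : Integrable F (Measure.pi D)) :
    Integrable (fun s => ∫ b, F (Function.update b i s) ∂(Measure.pi D)) (D i) ∧
    (∀ᵐ s ∂(D i), Integrable (fun b => F (Function.update b i s)) (Measure.pi D)) ∧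
    ∀ E : Set α, MeasurableSet E →
      ∫ b in {b | b i ∈ E}, F b ∂(Measure.pi D) =
        ∫ s in E, ∫ b, F (Function.update b i s) ∂(Measure.pi D) ∂(D i) := by
  have hmp := update_mp D i
  have hFc : Integrable (fun p : α × (Fin n → α) => F (Function.update p.2 i p.1))
      ((D i).prod (Measure.pi D)) := hmp.integrable_comp_of_integrable hF
  refine ⟨hFc.integral_prod_left, hFc.prod_right_ae, fun E hE => ?_⟩
  have hS : MeasurableSet {b : Fin n → α | b i ∈ E} := measurable_pi_apply i hE
  have h1 := hmp.restrict_preimage hS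
  have h2 : (fun p : α × (Fin n → α) => Function.update p.2 i p.1) ⁻¹' {b | b i ∈ E} =
      E ×ˢ Set.univ := by
    ext p; simp
  rw [h2] at h1
  rw [← h1.map_eq, integral_map h1.measurable.aemeasurable (by
    rw [h1.map_eq]; exact hF.aestronglyMeasurable.restrict)]
  rw [setIntegral_prod _ hFc.integrableOn]
  simp

theorem msupport_ae {m : ℕ} (μ : Measure (Fin m → ℝ)) : ∀ᵐ t ∂μ, t ∈ msupport μ := by
  rw [ae_iff]
  refine measure_null_of_locally_null _ fun x hx => ?_
  simp only [msupport, Set.mem_ofPred_eq, not_forall] at hx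
  obtain ⟨U, hU, hxU, h0⟩ := hx
  exact ⟨U, mem_nhdsWithin_of_mem_nhds (hU.mem_nhds hxU), by simpa using h0⟩

theorem box_ae {m : ℕ} (H : ℝ) (μ : Measure (Fin m → ℝ)) [IsProbabilityMeasure μ]
    (h : suppBox H μ) : ∀ᵐ t ∂μ, ∀ j, t j ∈ Icc (0:ℝ) H := by
  have hm : MeasurableSet {t : Fin m → ℝ | ∀ j, t j ∈ Icc (0:ℝ) H} := by
    have : {t : Fin m → ℝ | ∀ j, t j ∈ Icc (0:ℝ) H} = ⋂ j, (fun t => t j) ⁻¹' Icc (0:ℝ) H := by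
      ext; simp
    rw [this]
    exact MeasurableSet.iInter fun j => measurable_pi_apply j measurableSet_Icc
  have := (prob_compl_eq_zero_iff hm).2 h
  exact this

theorem interim_facts {n m : ℕ} (H L : ℝ) (v : Fin n → (Fin m → ℝ) → Alloc n m → ℝ)
    (hL : ∀ i t t' x, |v i t x - v i t' x| ≤ L * ∑ j, |t j - t' j|) (hL0 : 0 ≤ L)
    (B : ℝ) (hv0 : ∀ i t x, 0 ≤ v i t x) (hvB : ∀ i t x, v i t x ≤ B)
    (hvm : ∀ i x, Measurable fun t => v i t x)
    (D : Fin n → Measure (Fin m → ℝ)) [∀ i, IsProbabilityMeasure (D i)]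
    (hD : ∀ i, suppBox H (D i)) (M : Mechanism n m) (hBIC : IsBIC 0 H v M D) (i : Fin n)
    (hp : Integrable (fun b => M.pay (fun j => some (b j)) i) (Measure.pi D)) :
    ∃ u : (Fin m → ℝ) → ℝ, Integrable u (D i) ∧ (∀ᵐ t ∂(D i), 0 ≤ u t) ∧
      ∀ E : Set (Fin m → ℝ), MeasurableSet E →
        (∀ᵐ t ∂(D i), (∑ x, (∫ b in {b | b i ∈ E}, M.allocProb (fun j => some (b j)) x
            ∂(Measure.pi D)) * (v i t x - v i t (emptyAlloc n m))) -
          ∫ b in {b | b i ∈ E}, M.pay (fun j => some (b j)) i ∂(Measure.pi D) ≤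
            (D i).real E * u t) ∧
        (∀ t δ, 0 ≤ δ → (∀ s ∈ E, (∀ j, s j ∈ Icc (0:ℝ) H) → ∑ j, |s j - t j| ≤ δ) →
          ∫ s in E, u s ∂(D i) - 2 * L * δ * (D i).real E ≤
          (∑ x, (∫ b in {b | b i ∈ E}, M.allocProb (fun j => some (b j)) x
            ∂(Measure.pi D)) * (v i t x - v i t (emptyAlloc n m))) -
          ∫ b in {b | b i ∈ E}, M.pay (fun j => some (b j)) i ∂(Measure.pi D)) := by
  have hsm : Measurable (fun b : Fin n → Fin m → ℝ => fun j => some (b j)) :=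
    measurable_pi_lambda _ fun j => measurable_some.comp (measurable_pi_apply j)
  have hle1 : ∀ b x, M.allocProb b x ≤ 1 := fun b x => by
    rw [← M.allocProb_sum_one b]
    exact Finset.single_le_sum (f := M.allocProb b) (fun _ _ => M.allocProb_nonneg _ _) (Finset.mem_univ x)
  have hfi : ∀ x, Integrable (fun b : Fin n → Fin m → ℝ => M.allocProb (fun j => some (b j)) x)
      (Measure.pi D) := fun x =>
    Integrable.of_bound ((M.meas_allocProb x).comp hsm).aestronglyMeasurable 1
      (Filter.Eventually.of_forall fun b => by
        rw [Real.norm_eq_abs, abs_of_nonneg (M.allocProb_nonneg _ _)]; exact hle1 _ _)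
  have hfu : ∀ x s, Integrable (fun b : Fin n → Fin m → ℝ =>
      M.allocProb (fun j => some (Function.update b i s j)) x) (Measure.pi D) := fun x s =>
    Integrable.of_bound (((M.meas_allocProb x).comp hsm).comp
      (measurable_update_left)).aestronglyMeasurable 1
      (Filter.Eventually.of_forall fun b => by
        rw [Real.norm_eq_abs, abs_of_nonneg (M.allocProb_nonneg _ _)]; exact hle1 _ _)
  set a : (Fin m → ℝ) → Alloc n m → ℝ := fun s x =>
    ∫ b, M.allocProb (fun j => some (Function.update b i s j)) x ∂(Measure.pi D) with ha
  set p : (Fin m → ℝ) → ℝ := fun s =>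
    ∫ b, M.pay (fun j => some (Function.update b i s j)) i ∂(Measure.pi D) with hpd
  have ha0 : ∀ s x, 0 ≤ a s x := fun s x => integral_nonneg fun b => M.allocProb_nonneg _ _
  have ha1 : ∀ s, ∑ x, a s x = 1 := by
    intro s
    simp only [ha]
    rw [← integral_finsetSum _ fun x _ => hfu x s]
    simp [M.allocProb_sum_one]
  have hafub := fun x => update_fubini D i _ (hfi x)
  obtain ⟨hpi, hpae, hpE⟩ := update_fubini D i _ hp
  have hai : ∀ x, Integrable (fun s => a s x) (D i) := fun x => (hafub x).1
  replace hpi : Integrable p (D i) := hpi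
  set u : (Fin m → ℝ) → ℝ := fun s => ∑ x, a s x * (v i s x - v i s (emptyAlloc n m)) - p s with hu
  have hui : Integrable u (D i) := by
    refine Integrable.sub (integrable_finsetSum _ fun x _ => ?_) hpi
    refine (hai x).mul_bdd (c := B) ((hvm i x).sub (hvm i _)).aestronglyMeasurable
      (Filter.Eventually.of_forall fun t => ?_)
    rw [Real.norm_eq_abs, abs_le]
    constructor <;> linarith [hv0 i t x, hv0 i t (emptyAlloc n m), hvB i t x,
      hvB i t (emptyAlloc n m)]
  have hintg : ∀ t s, Integrable (fun b => M.pay (fun j => some (Function.update b i s j)) i)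
      (Measure.pi D) → interim v M D i t (some s) =
        ∑ x, a s x * (v i t x - v i t (emptyAlloc n m)) - p s + v i t (emptyAlloc n m) := by
    intro t s hs
    unfold interim util
    have h1 : ∀ b : Fin n → Fin m → ℝ,
        (fun j => if j = i then some s else some (b j)) =
        fun j => some (Function.update b i s j) := by
      intro b; ext1 j
      by_cases hj : j = i
      · subst hj; simp
      · simp [hj]
    simp_rw [h1]
    rw [integral_sub (integrable_finsetSum _ fun x _ => (hfu x s).mul_const _) hs,
      integral_finsetSum _ fun x _ => (hfu x s).mul_const _]
    simp_rw [integral_mul_const, mul_sub, Finset.sum_sub_distrib, ← Finset.sum_mul]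
    rw [ha1]; simp only [hpd, ha]; ring
  have hnone : ∀ t, interim v M D i t none = v i t (emptyAlloc n m) := by
    intro t
    unfold interim util
    have : ∀ b : Fin n → Fin m → ℝ, ∃ l, (fun j => if j = i then none else some (b j)) l = none :=
      fun b => ⟨i, by simp⟩
    simp_rw [fun b => (M.optOut _ (this b)).1, fun b => (M.optOut _ (this b)).2]
    simp
  refine ⟨u, hui, ?_, fun E hE => ?_⟩
  · filter_upwards [msupport_ae (D i), hpae] with t ht htp
    have := hBIC i t ht none (by simp)
    rw [hnone, hintg t t htp] at this
    simp only [hu]; linarith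
  have hform : ∀ h : Alloc n m → ℝ, (∑ x, (∫ b in {b | b i ∈ E},
        M.allocProb (fun j => some (b j)) x ∂(Measure.pi D)) * h x) -
          ∫ b in {b | b i ∈ E}, M.pay (fun j => some (b j)) i ∂(Measure.pi D) =
      ∫ s in E, (∑ x, a s x * h x - p s) ∂(D i) := by
    intro h
    rw [integral_sub (integrable_finsetSum _ fun x _ => ((hai x).integrableOn.mul_const _))
      hpi.integrableOn, integral_finsetSum _ fun x _ => ((hai x).integrableOn.mul_const _)]
    simp_rw [integral_mul_const]
    rw [hpE E hE]
    simp_rw [fun x => (hafub x).2.2 E hE]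
    rfl
  have hfint : ∀ h : Alloc n m → ℝ, IntegrableOn (fun s => ∑ x, a s x * h x - p s) E (D i) :=
    fun h => ((integrable_finsetSum _ fun x _ => ((hai x).mul_const _)).sub hpi).integrableOn
  constructor
  · filter_upwards [msupport_ae (D i), hpae] with t ht htp
    rw [hform, ← smul_eq_mul, ← setIntegral_const]
    refine setIntegral_mono_ae (hfint _) (integrable_const _).integrableOn ?_
    filter_upwards [box_ae H (D i) (hD i), hpae] with s hs hsp
    have := hBIC i t ht (some s) (by simpa using hs)
    rw [hintg t s hsp, hintg t t htp] at this
    simp only [hu]; linarith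
  · intro t δ hδ hE2
    rw [hform]
    have : ∫ s in E, u s ∂(D i) - 2 * L * δ * (D i).real E = ∫ s in E, (u s - 2 * L * δ) ∂(D i) := by
      rw [integral_sub hui.integrableOn (integrable_const _).integrableOn, setIntegral_const]
      simp; ring
    rw [this]
    refine setIntegral_mono_on_ae (hui.integrableOn.sub (integrable_const _).integrableOn)
      (hfint _) hE ?_
    filter_upwards [box_ae H (D i) (hD i)] with s hs hsE
    have h1 := hE2 s hsE hs
    have h2 : ∑ x, a s x * (v i s x - v i s (emptyAlloc n m)) ≤
        ∑ x, (a s x * (v i t x - v i t (emptyAlloc n m)) + a s x * (2 * L * δ)) := by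
      refine Finset.sum_le_sum fun x _ => ?_
      rw [← mul_add]
      refine mul_le_mul_of_nonneg_left ?_ (ha0 _ _)
      have h3 := abs_le.1 (hL i s t x)
      have h4 := abs_le.1 (hL i s t (emptyAlloc n m))
      have h5 := mul_le_mul_of_nonneg_left h1 hL0
      linarith [h3.2, h4.1]
    rw [Finset.sum_add_distrib, ← Finset.sum_mul, ha1] at h2
    simp only [hu]; linarith

end MultiItem

open MeasureTheory Set
namespace MultiItem

theorem cell_sum {α K : Type*} [MeasurableSpace α] [Fintype K] (μ : Measure α) (c : α → K)
    (hc : ∀ κ, MeasurableSet (c ⁻¹' {κ})) (f : α → ℝ) (hf : Integrable f μ) :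
    ∑ κ, ∫ t in c ⁻¹' {κ}, f t ∂μ = ∫ t, f t ∂μ := by
  rw [← integral_iUnion_fintype hc ?_ fun κ => hf.integrableOn]
  · have : (⋃ κ, c ⁻¹' {κ}) = Set.univ := by ext; simp
    rw [this, setIntegral_univ]
  · intro κ κ' h
    refine Set.disjoint_left.2 fun t h1 h2 => h ?_
    simp only [Set.mem_preimage, Set.mem_singleton_iff] at h1 h2
    rw [← h1, h2]

theorem prok_symm {k : ℕ} {P Q : Measure (Fin k → ℝ)} {ε : ℝ} (h : ProkhorovLe P Q ε) :
    ProkhorovLe Q P ε := fun ε' h' A hA => (h ε' h' A hA).symm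

theorem bidder {m : ℕ} (μ ν : Measure (Fin m → ℝ)) [IsProbabilityMeasure μ]
    [IsProbabilityMeasure ν] (ε ε' : ℝ) (hε' : 0 ≤ ε') (hP : ProkhorovLe μ ν ε) (hlt : ε < ε')
    {K : Type} [Fintype K] [DecidableEq K] (c : (Fin m → ℝ) → K)
    (hc : ∀ κ, MeasurableSet (c ⁻¹' {κ})) (w0 : (Fin m → ℝ) → K → ℝ)
    (hw0m : ∀ κ, Measurable fun t => w0 t κ) (ℓ O W0 η : ℝ) (hℓ : 0 ≤ ℓ) (hO : 0 ≤ O) (hη : 0 ≤ η)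
    (hw0b : ∀ t κ, |w0 t κ| ≤ W0) (hosc : ∀ t t' κ, w0 t κ - w0 t' κ ≤ O)
    (hlip : ∀ t t' κ, w0 t κ - w0 t' κ ≤ ℓ * ∑ j, |t j - t' j|)
    (u : (Fin m → ℝ) → ℝ) (hu : Integrable u μ) (hu0 : ∀ᵐ t ∂μ, 0 ≤ u t)
    (hup : ∀ᵐ t ∂μ, ∀ κ, w0 t κ ≤ u t)
    (hlow : ∀ κ, ∀ᵐ t ∂μ, t ∈ c ⁻¹' {κ} →
      ∫ s in c ⁻¹' {κ}, u s ∂μ - η * μ.real (c ⁻¹' {κ}) ≤ μ.real (c ⁻¹' {κ}) * w0 t κ)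
    (γ ρ τ : ℝ) (hγ0 : 0 ≤ γ) (hγ1 : γ ≤ 1) (hρ0 : 0 < ρ) (hρ1 : ρ < 1) (hτ : 0 < τ) :
    ∃ (U : (Fin m → ℝ) → ℝ) (q : (Fin m → ℝ) → Option K → ℝ), Measurable U ∧ (∀ t, 0 ≤ U t) ∧
      (∃ W, ∀ t, U t ≤ W) ∧
      (∀ k, Measurable fun t => q t k) ∧ (∀ t k, 0 ≤ q t k) ∧ (∀ t, ∑ k, q t k = 1) ∧
      (∫ t, q t none ∂ν = ρ) ∧ (∀ κ, ∫ t, q t (some κ) ∂ν = (1 - ρ) * μ.real (c ⁻¹' {κ})) ∧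
      (∀ t κ, μ.real (c ⁻¹' {κ}) = 0 → q t (some κ) = 0) ∧
      (∀ t t', U t' + ∑ κ, q t' (some κ) * (γ * (w0 t κ - w0 t' κ)) ≤ U t) ∧
      -((2 * ((ℓ + O) * ε') + η + τ) / ρ) - τ ≤
        ∫ t, (∑ κ, q t (some κ) * (γ * w0 t κ) - U t) ∂ν := by
  set σ : K → ℝ := fun κ => μ.real (c ⁻¹' {κ}) with hσ
  have hσ0 : ∀ κ, 0 ≤ σ κ := fun κ => measureReal_nonneg
  have hσ1 : ∑ κ, σ κ = 1 := by
    have := cell_sum μ c hc (fun _ => 1) (integrable_const _)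
    simpa using this
  set w : (Fin m → ℝ) → Option K → ℝ := fun t o => o.elim 0 fun κ => γ * w0 t κ with hw
  have hW00 : 0 ≤ W0 := by
    by_contra hneg
    push Not at hneg
    have hemp : ∀ κ : K, False := fun κ => by linarith [abs_nonneg (w0 0 κ), hw0b 0 κ]
    have : IsEmpty K := ⟨hemp⟩
    simp at hσ1
  have hwm : ∀ k, Measurable fun t => w t k := by
    intro k; cases k with
    | none => exact measurable_const
    | some κ => exact (hw0m κ).const_mul γ
  have hwb : ∀ t k, |w t k| ≤ W0 := by
    intro t k; cases k with
    | none => simpa [hw] using hW00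
    | some κ =>
      show |γ * w0 t κ| ≤ W0
      rw [abs_mul, abs_of_nonneg hγ0]
      exact (mul_le_of_le_one_left (abs_nonneg _) hγ1).trans (hw0b _ _)
  -- scaling lemma
  have hsc : ∀ a X : ℝ, 0 ≤ X → a ≤ X → γ * a ≤ X := by
    intro a X hX ha
    nlinarith [mul_le_mul_of_nonneg_left ha hγ0]
  have hS0 : ∀ t t' : Fin m → ℝ, 0 ≤ ℓ * ∑ j, |t j - t' j| := fun t t' =>
    mul_nonneg hℓ (Finset.sum_nonneg fun _ _ => abs_nonneg _)
  have hwosc : ∀ t t' k, w t k - w t' k ≤ O := by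
    intro t t' k; cases k with
    | none => simpa [hw] using hO
    | some κ =>
      show γ * w0 t κ - γ * w0 t' κ ≤ O
      rw [← mul_sub]; exact hsc _ _ hO (hosc _ _ _)
  have hwlip : ∀ t t' k, w t k - w t' k ≤ ℓ * ∑ j, |t j - t' j| := by
    intro t t' k; cases k with
    | none => simpa [hw] using hS0 t t'
    | some κ =>
      show γ * w0 t κ - γ * w0 t' κ ≤ _
      rw [← mul_sub]; exact hsc _ _ (hS0 t t') (hlip _ _ _)
  set σ' : Option K → ℝ := fun o => o.elim ρ fun κ => (1 - ρ) * σ κ with hσ'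
  have hσ'0 : ∀ k, 0 ≤ σ' k := by
    intro k; cases k with
    | none => exact hρ0.le
    | some κ => exact mul_nonneg (by linarith) (hσ0 κ)
  have hσ'1 : ∑ k, σ' k = 1 := by
    rw [Fintype.sum_option]
    show ρ + ∑ κ, (1 - ρ) * σ κ = 1
    rw [← Finset.mul_sum, hσ1]; ring
  obtain ⟨φ, U, q, hφ0, hUm, hqm, hq0, hq1, hqi, hqz, hUlow, hIC, hUup⟩ :=
    ot_gen ν w hwm W0 hwb σ' hσ'0 hσ'1 none hρ0 τ hτ
  have hU0 : ∀ t, 0 ≤ U t := fun t => by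
    have := hUlow t none hρ0
    rw [hφ0] at this
    simpa [hw] using this
  have hIC' : ∀ t t', U t' + ∑ κ, q t' (some κ) * (γ * (w0 t κ - w0 t' κ)) ≤ U t := by
    intro t t'
    have h := hIC t t'
    rw [Fintype.sum_option] at h
    simp only [hw, Option.elim] at h
    simpa [mul_sub] using h
  have hqle : ∀ t k, q t k ≤ 1 := fun t k => by
    rw [← hq1 t]
    exact Finset.single_le_sum (f := fun j => q t j) (fun _ _ => hq0 _ _) (Finset.mem_univ k)
  have hUub : ∀ t, U t ≤ W0 + ∑ k, |φ k| + τ := by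
    intro t
    have h1 : ∑ k, q t k * (w t k - φ k) ≤ ∑ k, (q t k * W0 + |φ k|) := by
      refine Finset.sum_le_sum fun k _ => ?_
      have h2 := (abs_le.1 (hwb t k)).2
      have h3 := mul_le_mul_of_nonneg_left h2 (hq0 t k)
      have h4 := mul_le_mul_of_nonneg_left (neg_abs_le (φ k)) (hq0 t k)
      have h5 := mul_le_of_le_one_left (abs_nonneg (φ k)) (hqle t k)
      linarith
    rw [Finset.sum_add_distrib, ← Finset.sum_mul, hq1, one_mul] at h1
    linarith [hUup t]
  -- average of differences
  have hUdiff : ∀ t t' X, (∀ k, w t' k - w t k ≤ X) → U t' - U t ≤ X := by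
    intro t t' X hX
    have h := hIC t t'
    have h1 : ∑ k, q t' k * (w t' k - w t k) ≤ ∑ k, q t' k * X :=
      Finset.sum_le_sum fun k _ => mul_le_mul_of_nonneg_left (hX k) (hq0 _ _)
    rw [← Finset.sum_mul, hq1, one_mul] at h1
    have h2 : ∑ k, q t' k * (w t k - w t' k) = - ∑ k, q t' k * (w t' k - w t k) := by
      rw [← Finset.sum_neg_distrib]
      exact Finset.sum_congr rfl fun k _ => by ring
    linarith
  set Wp := (ℓ + O) * ε' with hWp
  have hUi : ∀ (π : Measure (Fin m → ℝ)) [IsProbabilityMeasure π], Integrable U π := fun π _ =>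
    Integrable.of_bound hUm.aestronglyMeasurable (W0 + ∑ k, |φ k| + τ)
      (Filter.Eventually.of_forall fun t => by
        rw [Real.norm_eq_abs, abs_of_nonneg (hU0 t)]; exact hUub t)
  have hUprok : ∫ t, U t ∂μ ≤ ∫ t, U t ∂ν + Wp :=
    prok_integral μ ν ε ε' hε' hP hlt U hUm ℓ O hℓ hO
      (fun t t' => hUdiff _ _ _ fun k => hwosc _ _ _)
      (fun t t' => hUdiff _ _ _ fun k => hwlip _ _ _)
  set G : (Fin m → ℝ) → ℝ := fun t => Finset.univ.sup' ⟨none, Finset.mem_univ _⟩ (w t) with hG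
  have hwG : ∀ t k, w t k ≤ G t := fun t k => Finset.le_sup' (w t) (Finset.mem_univ k)
  have hGm : Measurable G := by
    have : G = Finset.univ.sup' ⟨none, Finset.mem_univ _⟩ (fun k t => w t k) := by
      ext t; exact (Finset.sup'_apply ⟨none, Finset.mem_univ _⟩ (fun k (t : Fin m → ℝ) => w t k) t).symm
    rw [this]
    exact Finset.measurable_sup' _ fun k _ => hwm k
  have hGdiff : ∀ t t' X, (∀ k, w t k - w t' k ≤ X) → G t - G t' ≤ X := by
    intro t t' X hX
    have : G t ≤ G t' + X := Finset.sup'_le _ _ fun k _ => by linarith [hX k, hwG t' k]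
    linarith
  have hGb : ∀ t, |G t| ≤ W0 := fun t => abs_le.2
    ⟨by linarith [hwG t none, (abs_le.1 (hwb t none)).1],
      Finset.sup'_le _ _ fun k _ => (abs_le.1 (hwb t k)).2⟩
  have hGi : ∀ (π : Measure (Fin m → ℝ)) [IsProbabilityMeasure π], Integrable G π := fun π _ =>
    Integrable.of_bound hGm.aestronglyMeasurable W0 (Filter.Eventually.of_forall hGb)
  have hGprok : ∫ t, G t ∂ν ≤ ∫ t, G t ∂μ + Wp :=
    prok_integral ν μ ε ε' hε' (prok_symm hP) hlt G hGm ℓ O hℓ hO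
      (fun t t' => hGdiff _ _ _ fun k => hwosc _ _ _)
      (fun t t' => hGdiff _ _ _ fun k => hwlip _ _ _)
  have hGu : ∫ t, G t ∂μ ≤ γ * ∫ t, u t ∂μ := by
    rw [← integral_const_mul]
    refine integral_mono_ae (hGi μ) (hu.const_mul γ) ?_
    filter_upwards [hu0, hup] with t h0 h1
    refine Finset.sup'_le _ _ fun k _ => ?_
    cases k with
    | none => exact mul_nonneg hγ0 h0
    | some κ => exact mul_le_mul_of_nonneg_left (h1 κ) hγ0
  set S := ∑ κ, σ κ * φ (some κ) with hS
  have hqint : ∀ k, Integrable (fun t => q t k) ν := fun k =>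
    Integrable.of_bound (hqm k).aestronglyMeasurable 1 (Filter.Eventually.of_forall fun t => by
      rw [Real.norm_eq_abs, abs_of_nonneg (hq0 t k)]; exact hqle t k)
  have hqφi : Integrable (fun t => ∑ k, q t k * φ k) ν :=
    integrable_finsetSum _ fun k _ => (hqint k).mul_const _
  have hqφ : ∫ t, ∑ k, q t k * φ k ∂ν = (1 - ρ) * S := by
    rw [integral_finsetSum _ fun k _ => (hqint k).mul_const _]
    simp_rw [integral_mul_const, hqi]
    rw [Fintype.sum_option, hφ0, hS, Finset.mul_sum]
    simp [hσ', mul_assoc]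
  have hUν : ∫ t, U t ∂ν ≤ ∫ t, G t ∂ν - (1 - ρ) * S + τ := by
    rw [← hqφ, ← integral_sub (hGi ν) hqφi]
    have : ∫ t, (G t - ∑ k, q t k * φ k) ∂ν + τ = ∫ t, ((G t - ∑ k, q t k * φ k) + τ) ∂ν := by
      have hgs : Integrable (fun t => G t - ∑ k, q t k * φ k) ν := (hGi ν).sub hqφi
      rw [integral_add hgs (integrable_const _)]; simp
    rw [this]
    refine integral_mono (hUi ν) (((hGi ν).sub hqφi).add (integrable_const _)) fun t => ?_
    have h1 : ∑ k, q t k * (w t k - φ k) ≤ ∑ k, (q t k * G t - q t k * φ k) :=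
      Finset.sum_le_sum fun k _ => by
        have := mul_le_mul_of_nonneg_left (hwG t k) (hq0 t k)
        linarith
    rw [Finset.sum_sub_distrib, ← Finset.sum_mul, hq1, one_mul] at h1
    show U t ≤ _
    linarith [hUup t]
  have hcell : ∀ κ, γ * (∫ t in c ⁻¹' {κ}, u t ∂μ - η * σ κ) - σ κ * φ (some κ) ≤
      ∫ t in c ⁻¹' {κ}, U t ∂μ := by
    intro κ
    rcases (hσ0 κ).eq_or_lt with h0 | hpos
    · have hz : μ (c ⁻¹' {κ}) = 0 := (measureReal_eq_zero_iff).1 h0.symm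
      rw [setIntegral_measure_zero _ hz, setIntegral_measure_zero _ hz, ← h0]
      simp
    · have h1 : ∫ t in c ⁻¹' {κ}, (γ * (∫ t in c ⁻¹' {κ}, u t ∂μ - η * σ κ) / σ κ - φ (some κ)) ∂μ ≤
          ∫ t in c ⁻¹' {κ}, U t ∂μ := by
        refine setIntegral_mono_on_ae (integrable_const _).integrableOn (hUi μ).integrableOn
          (hc κ) ?_
        filter_upwards [hlow κ] with t ht htc
        have h2 := ht htc
        have h3 : γ * w0 t κ - φ (some κ) ≤ U t :=
          hUlow t (some κ) (mul_pos (by linarith) hpos)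
        have h4 : γ * (∫ t in c ⁻¹' {κ}, u t ∂μ - η * σ κ) / σ κ ≤ γ * w0 t κ := by
          rw [div_le_iff₀ hpos]
          have := mul_le_mul_of_nonneg_left h2 hγ0
          calc _ ≤ _ := this
            _ = γ * w0 t κ * σ κ := by simp only [hσ]; ring
        linarith
      rw [setIntegral_const, smul_eq_mul] at h1
      refine le_trans (le_of_eq ?_) h1
      show _ = σ κ * _
      field_simp
  have hUμ : γ * ∫ t, u t ∂μ - η - S ≤ ∫ t, U t ∂μ := by
    rw [← cell_sum μ c hc U (hUi μ)]
    have h1 := Finset.sum_le_sum fun κ (_ : κ ∈ Finset.univ) => hcell κ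
    rw [Finset.sum_sub_distrib, ← Finset.mul_sum, Finset.sum_sub_distrib, cell_sum μ c hc u hu,
      ← Finset.mul_sum, hσ1] at h1
    have := hsc η η hη le_rfl
    refine le_trans ?_ h1
    show _ ≤ _ - S
    nlinarith
  have hρS : -((2 * Wp + η + τ) / ρ) ≤ S := by
    rw [neg_le, le_div_iff₀ hρ0]
    linarith
  refine ⟨U, q, hUm, hU0, ⟨_, hUub⟩, hqm, hq0, hq1, hqi none, fun κ => hqi (some κ), ?_, hIC', ?_⟩
  · intro t κ h
    refine hqz t (some κ) ?_
    show (1 - ρ) * σ κ = 0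
    simp only [hσ]; rw [h, mul_zero]
  · have hwi : Integrable (fun t => ∑ κ, q t (some κ) * (γ * w0 t κ)) ν := by
      refine integrable_finsetSum _ fun κ _ => ?_
      refine (hqint (some κ)).mul_bdd (c := W0) ((hw0m κ).const_mul γ).aestronglyMeasurable
        (Filter.Eventually.of_forall fun t => hwb t (some κ))
    have h1 : ∫ t, (∑ k, q t k * φ k - τ) ∂ν ≤ ∫ t, (∑ κ, q t (some κ) * (γ * w0 t κ) - U t) ∂ν := by
      refine integral_mono (hqφi.sub (integrable_const _)) (hwi.sub (hUi ν)) fun t => ?_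
      have h2 := hUup t
      simp_rw [mul_sub, Finset.sum_sub_distrib] at h2
      rw [Fintype.sum_option] at h2
      simp only [hw, Option.elim, mul_zero, zero_add] at h2
      show _ - τ ≤ _ - U t
      linarith
    rw [integral_sub hqφi (integrable_const _), hqφ] at h1
    simp only [integral_const, probReal_univ, one_smul] at h1
    refine le_trans ?_ h1
    have h3 : 0 ≤ (2 * Wp + η + τ) / ρ := by
      have : 0 ≤ Wp := mul_nonneg (by linarith) hε'
      positivity
    have h4 := mul_le_mul_of_nonneg_left hρS (by linarith : 0 ≤ 1 - ρ)
    nlinarith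

end MultiItem

open MeasureTheory Set
namespace MultiItem

theorem alloc_split {n m : ℕ} (D : Fin n → Measure (Fin m → ℝ))
    [∀ i, IsProbabilityMeasure (D i)] (M : Mechanism n m)
    {K : Type} [Fintype K] [DecidableEq K] (c : (Fin m → ℝ) → K)
    (hc : ∀ κ, MeasurableSet (c ⁻¹' {κ})) (ρ : ℝ) (Q : Fin n → Option K → ℝ)
    (hQs : ∀ l κ, Q l (some κ) = (1 - ρ) * (D l).real (c ⁻¹' {κ})) :
    ∃ A : (Fin n → Option K) → Alloc n m → ℝ, (∀ k x, 0 ≤ A k x) ∧ (∀ k, ∑ x, A k x = 1) ∧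
      ∀ (i : Fin n) (h : Alloc n m → ℝ), h (emptyAlloc n m) = 0 →
        (∑ x, (∑ k : Fin n → Option K, if k i = none then
          (∏ l ∈ Finset.univ.erase i, Q l (k l)) * A k x else 0) * h x = 0) ∧
        ∀ κ, (D i).real (c ⁻¹' {κ}) * ∑ x, (∑ k : Fin n → Option K, if k i = some κ then
          (∏ l ∈ Finset.univ.erase i, Q l (k l)) * A k x else 0) * h x =
          (1 - ρ) ^ (n - 1) * ∑ x, (∫ b in {b | b i ∈ c ⁻¹' {κ}},
            M.allocProb (fun j => some (b j)) x ∂(Measure.pi D)) * h x := by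
  classical
  have hsm : Measurable (fun b : Fin n → Fin m → ℝ => fun j => some (b j)) :=
    measurable_pi_lambda _ fun j => measurable_some.comp (measurable_pi_apply j)
  have hle1 : ∀ b x, M.allocProb b x ≤ 1 := fun b x => by
    rw [← M.allocProb_sum_one b]
    exact Finset.single_le_sum (f := M.allocProb b) (fun _ _ => M.allocProb_nonneg _ _)
      (Finset.mem_univ x)
  have hfi : ∀ x, Integrable (fun b : Fin n → Fin m → ℝ => M.allocProb (fun j => some (b j)) x)
      (Measure.pi D) := fun x =>
    Integrable.of_bound ((M.meas_allocProb x).comp hsm).aestronglyMeasurable 1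
      (Filter.Eventually.of_forall fun b => by
        rw [Real.norm_eq_abs, abs_of_nonneg (M.allocProb_nonneg _ _)]; exact hle1 _ _)
  set σ : Fin n → K → ℝ := fun i κ => (D i).real (c ⁻¹' {κ}) with hσ
  set cc : (Fin n → Fin m → ℝ) → (Fin n → K) := fun b l => c (b l) with hcc
  have hpre : ∀ k, cc ⁻¹' {k} = Set.univ.pi fun l => c ⁻¹' {k l} := by
    intro k; ext b
    simp only [hcc, Set.mem_preimage, Set.mem_singleton_iff, Set.mem_univ_pi]
    exact funext_iff
  have hccm : ∀ k, MeasurableSet (cc ⁻¹' {k}) := fun k => by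
    rw [hpre]; exact MeasurableSet.univ_pi fun l => hc _
  have hreal : ∀ k, (Measure.pi D).real (cc ⁻¹' {k}) = ∏ l, σ l (k l) := by
    intro k
    rw [hpre, Measure.real, Measure.pi_pi, ENNReal.toReal_prod]; rfl
  set Z : (Fin n → K) → Alloc n m → ℝ := fun k x =>
    ∫ b in cc ⁻¹' {k}, M.allocProb (fun j => some (b j)) x ∂(Measure.pi D) with hZ
  have hZ0 : ∀ k x, 0 ≤ Z k x := fun k x => integral_nonneg fun b => M.allocProb_nonneg _ _
  have hZ1 : ∀ k, ∑ x, Z k x = ∏ l, σ l (k l) := by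
    intro k
    simp only [hZ]
    rw [← integral_finsetSum _ fun x _ => (hfi x).integrableOn]
    simp [M.allocProb_sum_one, ← hreal]
  have hBu : ∀ i κ x, ∑ k, (if k i = κ then Z k x else 0) =
      ∫ b in {b | b i ∈ c ⁻¹' {κ}}, M.allocProb (fun j => some (b j)) x ∂(Measure.pi D) := by
    intro i κ x
    rw [← cell_sum ((Measure.pi D).restrict {b | b i ∈ c ⁻¹' {κ}}) cc hccm _ (hfi x).integrableOn]
    refine Finset.sum_congr rfl fun k _ => ?_
    rw [Measure.restrict_restrict (hccm k)]
    split_ifs with hk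
    · have : cc ⁻¹' {k} ∩ {b | b i ∈ c ⁻¹' {κ}} = cc ⁻¹' {k} := by
        refine Set.inter_eq_left.2 fun b hb => ?_
        have hb' : cc b = k := hb
        show c (b i) = κ
        rw [← hk, ← hb']
      rw [this]
    · have : cc ⁻¹' {k} ∩ {b | b i ∈ c ⁻¹' {κ}} = ∅ := by
        refine Set.eq_empty_of_forall_notMem fun b hb => hk ?_
        have hb' : cc b = k := hb.1
        have hb2 : c (b i) = κ := hb.2
        rw [← hb', ← hb2]
      rw [this]; simp
  set A0 : (Fin n → K) → Alloc n m → ℝ := fun k x =>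
    if ∏ l, σ l (k l) = 0 then (if x = emptyAlloc n m then 1 else 0)
    else Z k x / ∏ l, σ l (k l) with hA0
  have hσ0 : ∀ i κ, 0 ≤ σ i κ := fun i κ => measureReal_nonneg
  have hA00 : ∀ k x, 0 ≤ A0 k x := by
    intro k x
    simp only [hA0]
    split_ifs
    · exact zero_le_one
    · exact le_rfl
    · exact div_nonneg (hZ0 _ _) (Finset.prod_nonneg fun l _ => hσ0 _ _)
  have hA01 : ∀ k, ∑ x, A0 k x = 1 := by
    intro k
    simp only [hA0]
    split_ifs with h
    · simp
    · rw [← Finset.sum_div, hZ1, div_self h]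
  have hA0Z : ∀ k x, (∏ l, σ l (k l)) * A0 k x = Z k x := by
    intro k x
    simp only [hA0]
    split_ifs with h h2
    · have h3 : Z k x ≤ 0 := by
        rw [← h, ← hZ1]
        exact Finset.single_le_sum (f := Z k) (fun _ _ => hZ0 _ _) (Finset.mem_univ x)
      rw [h]; linarith [hZ0 k x]
    · have h3 : Z k x ≤ 0 := by
        rw [← h, ← hZ1]
        exact Finset.single_le_sum (f := Z k) (fun _ _ => hZ0 _ _) (Finset.mem_univ x)
      rw [h]; linarith [hZ0 k x]
    · rw [mul_div_cancel₀ _ h]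
  set A : (Fin n → Option K) → Alloc n m → ℝ := fun k x =>
    if h : ∀ i, (k i).isSome then A0 (fun i => (k i).get (h i)) x
    else (if x = emptyAlloc n m then 1 else 0) with hA
  have hAn : ∀ (k : Fin n → Option K) (h : Alloc n m → ℝ), h (emptyAlloc n m) = 0 →
      (¬ ∀ i, (k i).isSome) → ∑ x, A k x * h x = 0 := by
    intro k h h0 hk
    simp only [hA, dif_neg hk]
    simp [h0]
  have hAs : ∀ (k : Fin n → K) x, A (fun i => some (k i)) x = A0 k x := by
    intro k x
    simp only [hA]
    rw [dif_pos (by simp)]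
    simp
  have hswap : ∀ (i : Fin n) (j : Option K) (h : Alloc n m → ℝ),
      ∑ x, (∑ k : Fin n → Option K, if k i = j then
          (∏ l ∈ Finset.univ.erase i, Q l (k l)) * A k x else 0) * h x =
      ∑ k : Fin n → Option K, if k i = j then
          (∏ l ∈ Finset.univ.erase i, Q l (k l)) * ∑ x, A k x * h x else 0 := by
    intro i j h
    simp_rw [Finset.sum_mul]
    rw [Finset.sum_comm]
    refine Finset.sum_congr rfl fun k _ => ?_
    split_ifs
    · rw [Finset.mul_sum]
      exact Finset.sum_congr rfl fun x _ => by ring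
    · simp
  refine ⟨A, ?_, ?_, fun i h h0 => ⟨?_, fun κ => ?_⟩⟩
  · intro k x
    simp only [hA]
    split_ifs
    · exact hA00 _ _
    · exact zero_le_one
    · exact le_rfl
  · intro k
    simp only [hA]
    split_ifs
    · exact hA01 _
    · simp
  · rw [hswap]
    refine Finset.sum_eq_zero fun k _ => ?_
    split_ifs with hk
    · rw [hAn k h h0 (fun hh => by simpa [hk] using hh i), mul_zero]
    · rfl
  · rw [hswap]
    have h1 : ∑ k : Fin n → Option K, (if k i = some κ then
          (∏ l ∈ Finset.univ.erase i, Q l (k l)) * ∑ x, A k x * h x else 0) =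
        ∑ k : Fin n → K, (if k i = κ then
          (∏ l ∈ Finset.univ.erase i, (1 - ρ) * σ l (k l)) * ∑ x, A0 k x * h x else 0) := by
      symm
      refine Finset.sum_of_injOn (fun k i => some (k i)) ?_ (by simp) ?_ ?_
      · intro k _ k' _ hkk
        funext l
        exact Option.some_injective _ (congrFun hkk l)
      · intro k _ hk
        rw [hAn k h h0, mul_zero, ite_self]
        intro hh
        refine hk ⟨fun l => (k l).get (hh l), by simp, ?_⟩
        funext l; simp
      · intro k _
        simp only [hAs, hQs, Option.some.injEq, hσ]
    rw [h1, Finset.mul_sum]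
    simp_rw [← hBu]
    have h2 : ∀ k : Fin n → K, (D i).real (c ⁻¹' {κ}) * (if k i = κ then
          (∏ l ∈ Finset.univ.erase i, (1 - ρ) * σ l (k l)) * ∑ x, A0 k x * h x else 0) =
        (1 - ρ) ^ (n - 1) * ∑ x, (if k i = κ then Z k x else 0) * h x := by
      intro k
      split_ifs with hk
      · rw [Finset.prod_mul_distrib, Finset.prod_const, Finset.card_erase_of_mem (Finset.mem_univ i),
          Finset.card_univ, Fintype.card_fin]
        have h3 : (D i).real (c ⁻¹' {κ}) * ∏ l ∈ Finset.univ.erase i, σ l (k l) =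
            ∏ l, σ l (k l) := by
          rw [← Finset.mul_prod_erase _ _ (Finset.mem_univ i), hk]
        simp_rw [← hA0Z, ← h3, Finset.mul_sum]
        exact Finset.sum_congr rfl fun x _ => by ring
      · simp
    simp_rw [h2, ← Finset.mul_sum]
    rw [Finset.sum_comm]
    simp_rw [Finset.sum_mul]

end MultiItem

open MeasureTheory Set
namespace MultiItem

theorem one_sided {n m : ℕ} (H L : ℝ) (v : Fin n → (Fin m → ℝ) → Alloc n m → ℝ)
    (hL : ∀ i t t' x, |v i t x - v i t' x| ≤ L * ∑ j, |t j - t' j|) (hL0 : 0 ≤ L)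
    (B : ℝ) (hB : 0 ≤ B) (hv0 : ∀ i t x, 0 ≤ v i t x) (hvB : ∀ i t x, v i t x ≤ B)
    (hvm : ∀ i x, Measurable fun t => v i t x)
    (D Dh : Fin n → Measure (Fin m → ℝ)) [∀ i, IsProbabilityMeasure (D i)]
    [∀ i, IsProbabilityMeasure (Dh i)]
    (hD : ∀ i, suppBox H (D i)) (ε ε' : ℝ) (hε' : 0 ≤ ε')
    (hP : ∀ i, ProkhorovLe (D i) (Dh i) ε) (hlt : ε < ε')
    (M : Mechanism n m) (hBIC : IsBIC 0 H v M D)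
    (hp : ∀ i, Integrable (fun b => M.pay (fun j => some (b j)) i) (Measure.pi D))
    {K : Type} [Fintype K] [DecidableEq K] (c : (Fin m → ℝ) → K)
    (hc : ∀ κ, MeasurableSet (c ⁻¹' {κ})) (δ : ℝ) (hδ : 0 ≤ δ)
    (hcδ : ∀ s t : Fin m → ℝ, (∀ j, s j ∈ Icc (0:ℝ) H) → (∀ j, t j ∈ Icc (0:ℝ) H) → c s = c t →
      ∑ j, |s j - t j| ≤ δ)
    (ρ τ : ℝ) (hρ0 : 0 < ρ) (hρ1 : ρ < 1) (hτ : 0 < τ) :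
    ∃ Mh : Mechanism n m, IsIR H v Mh ∧ IsBIC 0 H v Mh Dh ∧
      (1 - ρ) ^ n * RevT M D -
        n * ((2 * ((2 * L + 2 * B) * ε') + 2 * L * δ + τ) / ρ + τ) ≤ RevT Mh Dh := by
  classical
  have hsm : Measurable (fun b : Fin n → Fin m → ℝ => fun j => some (b j)) :=
    measurable_pi_lambda _ fun j => measurable_some.comp (measurable_pi_apply j)
  have hle1 : ∀ b x, M.allocProb b x ≤ 1 := fun b x => by
    rw [← M.allocProb_sum_one b]
    exact Finset.single_le_sum (f := M.allocProb b) (fun _ _ => M.allocProb_nonneg _ _)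
      (Finset.mem_univ x)
  have hfi : ∀ x, Integrable (fun b : Fin n → Fin m → ℝ => M.allocProb (fun j => some (b j)) x)
      (Measure.pi D) := fun x =>
    Integrable.of_bound ((M.meas_allocProb x).comp hsm).aestronglyMeasurable 1
      (Filter.Eventually.of_forall fun b => by
        rw [Real.norm_eq_abs, abs_of_nonneg (M.allocProb_nonneg _ _)]; exact hle1 _ _)
  set σ : Fin n → K → ℝ := fun i κ => (D i).real (c ⁻¹' {κ}) with hσ
  have hσ0 : ∀ i κ, 0 ≤ σ i κ := fun i κ => measureReal_nonneg
  set Bu : Fin n → K → Alloc n m → ℝ := fun i κ x =>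
    ∫ b in {b | b i ∈ c ⁻¹' {κ}}, M.allocProb (fun j => some (b j)) x ∂(Measure.pi D) with hBu
  set Pu : Fin n → K → ℝ := fun i κ =>
    ∫ b in {b | b i ∈ c ⁻¹' {κ}}, M.pay (fun j => some (b j)) i ∂(Measure.pi D) with hPu
  have hBu0 : ∀ i κ x, 0 ≤ Bu i κ x := fun i κ x => integral_nonneg fun b => M.allocProb_nonneg _ _
  have hBu1 : ∀ i κ, ∑ x, Bu i κ x = σ i κ := by
    intro i κ
    simp only [hBu]
    rw [← integral_finsetSum _ fun x _ => (hfi x).integrableOn]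
    simp only [M.allocProb_sum_one]
    rw [(update_fubini D i (fun _ => 1) (integrable_const _)).2.2 _ (hc κ)]
    simp [hσ]
  have hPu0 : ∀ i κ, σ i κ = 0 → Pu i κ = 0 := by
    intro i κ h
    simp only [hPu]
    rw [(update_fubini D i _ (hp i)).2.2 _ (hc κ), setIntegral_measure_zero]
    exact (measureReal_eq_zero_iff).1 h
  have hPu1 : ∀ i, ∑ κ, Pu i κ = ∫ b, M.pay (fun j => some (b j)) i ∂(Measure.pi D) := by
    intro i
    exact cell_sum (Measure.pi D) (fun b => c (b i)) (fun κ => show MeasurableSet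
      ((fun b : Fin n → Fin m → ℝ => b i) ⁻¹' (c ⁻¹' {κ})) from measurable_pi_apply i (hc κ)) _ (hp i)
  set g : Fin n → (Fin m → ℝ) → Alloc n m → ℝ := fun i t x => v i t x - v i t (emptyAlloc n m)
    with hg
  have hgm : ∀ i x, Measurable fun t => g i t x := fun i x => (hvm i x).sub (hvm i _)
  have hgb : ∀ i t x, |g i t x| ≤ B := fun i t x => abs_le.2
    ⟨by linarith [hv0 i t x, hvB i t (emptyAlloc n m)],
      by linarith [hvB i t x, hv0 i t (emptyAlloc n m)]⟩
  have hglip : ∀ i t t' x, g i t x - g i t' x ≤ 2 * L * ∑ j, |t j - t' j| := by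
    intro i t t' x
    have h3 := abs_le.1 (hL i t t' x)
    have h4 := abs_le.1 (hL i t t' (emptyAlloc n m))
    simp only [hg]; linarith [h3.2, h4.1]
  have hgosc : ∀ i t t' x, g i t x - g i t' x ≤ 2 * B := fun i t t' x => by
    linarith [(abs_le.1 (hgb i t x)).2, (abs_le.1 (hgb i t' x)).1]
  set w0 : Fin n → (Fin m → ℝ) → K → ℝ := fun i t κ =>
    (∑ x, Bu i κ x * g i t x - Pu i κ) / σ i κ with hw0
  have hw0m : ∀ i κ, Measurable fun t => w0 i t κ := fun i κ =>
    ((Finset.measurable_sum _ fun x _ => (hgm i x).const_mul _).sub_const _).div_const _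
  have hdiff : ∀ i t t' κ X, 0 ≤ X → (∀ x, g i t x - g i t' x ≤ X) →
      w0 i t κ - w0 i t' κ ≤ X := by
    intro i t t' κ X hX hx
    simp only [hw0]
    rw [← sub_div]
    refine div_le_of_le_mul₀ (hσ0 _ _) hX ?_
    have h1 : ∑ x, Bu i κ x * (g i t x - g i t' x) ≤ ∑ x, Bu i κ x * X :=
      Finset.sum_le_sum fun x _ => mul_le_mul_of_nonneg_left (hx x) (hBu0 _ _ _)
    rw [← Finset.sum_mul, hBu1] at h1
    simp_rw [mul_sub, Finset.sum_sub_distrib] at h1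
    linarith
  have hw0b : ∀ i, ∃ W0, ∀ t κ, |w0 i t κ| ≤ W0 := by
    intro i
    refine ⟨∑ κ, (B + |Pu i κ|/ σ i κ), fun t κ => ?_⟩
    refine le_trans ?_ (Finset.single_le_sum (f := fun κ => B + |Pu i κ|/ σ i κ)
      (fun κ _ => add_nonneg hB (div_nonneg (abs_nonneg _) (hσ0 _ _))) (Finset.mem_univ κ))
    simp only [hw0]
    rw [abs_div, abs_of_nonneg (hσ0 i κ)]
    rcases (hσ0 i κ).eq_or_lt with h0 | hpos
    · rw [← h0]; simpa using hB
    · rw [div_le_iff₀ hpos, add_mul, div_mul_cancel₀ _ hpos.ne']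
      refine (abs_sub _ _).trans (add_le_add ?_ le_rfl)
      refine (Finset.abs_sum_le_sum_abs _ _).trans ?_
      rw [← hBu1, Finset.mul_sum]
      refine Finset.sum_le_sum fun x _ => ?_
      rw [abs_mul, abs_of_nonneg (hBu0 _ _ _), mul_comm]
      exact mul_le_mul_of_nonneg_right (hgb _ _ _) (hBu0 _ _ _)
  have hS0 : ∀ t t' : Fin m → ℝ, 0 ≤ 2 * L * ∑ j, |t j - t' j| := fun t t' =>
    mul_nonneg (by linarith) (Finset.sum_nonneg fun _ _ => abs_nonneg _)
  set γ := (1 - ρ) ^ (n - 1) with hγ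
  have hγ0 : 0 ≤ γ := pow_nonneg (by linarith) _
  have hγ1 : γ ≤ 1 := pow_le_one₀ (by linarith) (by linarith)
  have key : ∀ i, ∃ (U : (Fin m → ℝ) → ℝ) (q : (Fin m → ℝ) → Option K → ℝ), Measurable U ∧
      (∀ t, 0 ≤ U t) ∧ (∃ W, ∀ t, U t ≤ W) ∧
      (∀ k, Measurable fun t => q t k) ∧ (∀ t k, 0 ≤ q t k) ∧ (∀ t, ∑ k, q t k = 1) ∧
      (∫ t, q t none ∂(Dh i) = ρ) ∧ (∀ κ, ∫ t, q t (some κ) ∂(Dh i) = (1 - ρ) * σ i κ) ∧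
      (∀ t κ, σ i κ = 0 → q t (some κ) = 0) ∧
      (∀ t t', U t' + ∑ κ, q t' (some κ) * (γ * (w0 i t κ - w0 i t' κ)) ≤ U t) ∧
      -((2 * ((2 * L + 2 * B) * ε') + 2 * L * δ + τ) / ρ) - τ ≤
        ∫ t, (∑ κ, q t (some κ) * (γ * w0 i t κ) - U t) ∂(Dh i) := by
    intro i
    obtain ⟨u, hui, hu0, huE⟩ := interim_facts H L v hL hL0 B hv0 hvB hvm D hD M hBIC i (hp i)
    obtain ⟨W0, hW0⟩ := hw0b i
    refine bidder (D i) (Dh i) ε ε' hε' (hP i) hlt c hc (w0 i) (hw0m i) (2 * L) (2 * B) W0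
      (2 * L * δ) (by linarith) (by linarith) (by positivity) hW0
      (fun t t' κ => hdiff i t t' κ _ (by linarith) (hgosc i t t'))
      (fun t t' κ => hdiff i t t' κ _ (hS0 t t') (hglip i t t')) u hui hu0 ?_ ?_ γ ρ τ hγ0 hγ1
      hρ0 hρ1 hτ
    · have h1 := ae_all_iff.2 fun κ => (huE _ (hc κ)).1
      filter_upwards [h1, hu0] with t ht ht0 κ
      refine div_le_of_le_mul₀ (hσ0 _ _) ht0 ?_
      have := ht κ
      rw [mul_comm (u t)]
      exact this
    · intro κ
      filter_upwards [box_ae H (D i) (hD i)] with t ht htc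
      rcases (hσ0 i κ).eq_or_lt with h0 | hpos
      · have hz : (D i) (c ⁻¹' {κ}) = 0 := (measureReal_eq_zero_iff).1 h0.symm
        have h0' : (D i).real (c ⁻¹' {κ}) = 0 := h0.symm
        rw [setIntegral_measure_zero _ hz, h0']; simp
      · have h2 := (huE _ (hc κ)).2 t δ hδ fun s hs hsb => hcδ s t hsb ht (by
          have hs' : c s = κ := hs
          have ht' : c t = κ := htc
          rw [hs', ht'])
        refine h2.trans (le_of_eq ?_)
        show ∑ x, Bu i κ x * g i t x - Pu i κ = σ i κ * ((∑ x, Bu i κ x * g i t x - Pu i κ) / σ i κ)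
        rw [mul_div_cancel₀ _ hpos.ne']
  choose U q hUm hU0 hUW hqm hq0 hq1 hqn hqs hqz hIC hRev using key
  choose W hW using hUW
  obtain ⟨A, hA0, hA1, hAh⟩ := alloc_split D M c hc ρ (fun l k => ∫ t, q l t k ∂(Dh l)) hqs
  set a : Fin n → Option K → Alloc n m → ℝ := fun i j x =>
    ∑ k : Fin n → Option K, if k i = j then
        (∏ l ∈ Finset.univ.erase i, ∫ t, q l t (k l) ∂(Dh l)) * A k x else 0 with ha
  -- reduce the sums
  have hred : ∀ i t' (h : Alloc n m → ℝ), h (emptyAlloc n m) = 0 →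
      ∑ j, q i t' j * ∑ x, a i j x * h x =
        ∑ κ, q i t' (some κ) * (γ * ((∑ x, Bu i κ x * h x) / σ i κ)) := by
    intro i t' h h0
    rw [Fintype.sum_option, (hAh i h h0).1, mul_zero, zero_add]
    refine Finset.sum_congr rfl fun κ _ => ?_
    by_cases hz : σ i κ = 0
    · rw [hqz i t' κ hz]; simp
    · congr 1
      rw [← mul_div_assoc, eq_div_iff hz, mul_comm]
      exact (hAh i h h0).2 κ
  obtain ⟨Mh, hIR, hBICh, hrev⟩ := mech_exists H v B hv0 hvB hvm Dh q hqm hq0 hq1 A hA0 hA1 U hUm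
    hU0 (∑ i, |W i|) (fun i t => (hW i t).trans ((le_abs_self _).trans
      (Finset.single_le_sum (f := fun i => |W i|) (fun _ _ => abs_nonneg _) (Finset.mem_univ i))))
    a (fun i j x => rfl) (by
      intro i t t'
      rw [hred i t' _ (by ring)]
      refine le_trans (le_of_eq ?_) (hIC i t t')
      congr 1
      refine Finset.sum_congr rfl fun κ _ => ?_
      congr 2
      simp only [hw0]
      rw [← sub_div]
      congr 1
      rw [sub_sub_sub_cancel_right, ← Finset.sum_sub_distrib]
      exact Finset.sum_congr rfl fun x _ => by simp only [hg]; ring)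
  refine ⟨Mh, hIR, hBICh, ?_⟩
  rw [hrev]
  have hqle : ∀ i t j, q i t j ≤ 1 := fun i t j => by
    rw [← hq1 i t]
    exact Finset.single_le_sum (f := fun j => q i t j) (fun _ _ => hq0 _ _ _) (Finset.mem_univ j)
  have hqint : ∀ i k, Integrable (fun t => q i t k) (Dh i) := fun i k =>
    Integrable.of_bound (hqm i k).aestronglyMeasurable 1 (Filter.Eventually.of_forall fun t => by
      rw [Real.norm_eq_abs, abs_of_nonneg (hq0 i t k)]; exact hqle i t k)
  have hper : ∀ i, (1 - ρ) ^ n * ∫ b, M.pay (fun j => some (b j)) i ∂(Measure.pi D) -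
      ((2 * ((2 * L + 2 * B) * ε') + 2 * L * δ + τ) / ρ + τ) ≤
      ∫ t, ((∑ j, q i t j * ∑ x, a i j x *
        (v i t x - v i t (emptyAlloc n m))) - U i t) ∂(Dh i) := by
    intro i
    have hn : (1 - ρ) ^ n = (1 - ρ) * γ := by
      have : n = n - 1 + 1 := by have := i.pos; omega
      rw [hγ, ← pow_succ', ← this]
    have e1 : ∀ t, (∑ j, q i t j * ∑ x, a i j x * (v i t x - v i t (emptyAlloc n m))) - U i t =
        (∑ κ, q i t (some κ) * (γ * w0 i t κ) - U i t) +
          ∑ κ, q i t (some κ) * (γ * (Pu i κ / σ i κ)) := by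
      intro t
      rw [hred i t _ (by ring), sub_add_eq_add_sub, ← Finset.sum_add_distrib]
      congr 1
      refine Finset.sum_congr rfl fun κ _ => ?_
      simp only [hw0, hg]; ring
    simp_rw [e1]
    obtain ⟨W0, hW0⟩ := hw0b i
    have hwi : Integrable (fun t => ∑ κ, q i t (some κ) * (γ * w0 i t κ)) (Dh i) := by
      refine integrable_finsetSum _ fun κ _ => ?_
      refine (hqint i (some κ)).mul_bdd (c := γ * W0)
        ((hw0m i κ).const_mul γ).aestronglyMeasurable
        (Filter.Eventually.of_forall fun t => ?_)
      rw [Real.norm_eq_abs, abs_mul, abs_of_nonneg hγ0]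
      exact mul_le_mul_of_nonneg_left (hW0 t κ) hγ0
    have hUi : Integrable (U i) (Dh i) :=
      Integrable.of_bound (hUm i).aestronglyMeasurable (W i)
        (Filter.Eventually.of_forall fun t => by
          rw [Real.norm_eq_abs, abs_of_nonneg (hU0 i t)]; exact hW i t)
    have hwU : Integrable (fun t => ∑ κ, q i t (some κ) * (γ * w0 i t κ) - U i t) (Dh i) :=
      hwi.sub hUi
    have hlast : ∫ t, ∑ κ, q i t (some κ) * (γ * (Pu i κ / σ i κ)) ∂(Dh i) =
        (1 - ρ) ^ n * ∫ b, M.pay (fun j => some (b j)) i ∂(Measure.pi D) := by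
      rw [integral_finsetSum _ fun κ _ => (hqint i (some κ)).mul_const _]
      simp_rw [integral_mul_const, hqs]
      rw [← hPu1, Finset.mul_sum]
      refine Finset.sum_congr rfl fun κ _ => ?_
      by_cases hz : σ i κ = 0
      · rw [hPu0 i κ hz, hz]; simp
      · rw [hn]; field_simp
    rw [integral_add hwU (integrable_finsetSum _ fun κ _ => (hqint i (some κ)).mul_const _), hlast]
    linarith [hRev i]
  refine le_trans (le_of_eq ?_) (Finset.sum_le_sum fun i _ => hper i)
  unfold RevT
  rw [integral_finsetSum _ fun i _ => hp i, Finset.sum_sub_distrib, ← Finset.mul_sum]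
  simp
  ring

end MultiItem

open MeasureTheory Set
namespace MultiItem

theorem cells_exist (m : ℕ) (H δ : ℝ) (hδ : 0 < δ) :
    ∃ (N : ℕ) (c : (Fin m → ℝ) → (Fin m → Fin (N + 1))),
      (∀ κ, MeasurableSet (c ⁻¹' {κ})) ∧
      (∀ s t : Fin m → ℝ, (∀ j, s j ∈ Icc (0:ℝ) H) → (∀ j, t j ∈ Icc (0:ℝ) H) → c s = c t →
        ∑ j, |s j - t j| ≤ δ) := by
  set d := δ / (m + 1) with hd
  have hd0 : 0 < d := by positivity
  set N := ⌊H / d⌋₊ with hN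
  refine ⟨N, fun s j => ⟨min ⌊s j / d⌋₊ N, by omega⟩, ?_, ?_⟩
  · have hm : Measurable (fun (s : Fin m → ℝ) (j : Fin m) =>
        (⟨min ⌊s j / d⌋₊ N, by omega⟩ : Fin (N + 1))) := by
      refine measurable_pi_lambda _ fun j => ?_
      have h0 : Measurable (fun s : Fin m → ℝ => s j) := measurable_pi_apply j
      have h1 : Measurable (fun s : Fin m → ℝ => ⌊s j / d⌋₊) :=
        Nat.measurable_floor.comp (h0.div_const d)
      exact (measurable_from_top (f := fun k : ℕ => (⟨min k N, by omega⟩ : Fin (N + 1)))).comp h1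
    exact fun κ => hm (measurableSet_singleton κ)
  · intro s t hs ht h
    have h1 : ∀ j, |s j - t j| ≤ d := by
      intro j
      have h2 := congrArg Fin.val (congrFun h j)
      simp only at h2
      have hsN : ⌊s j / d⌋₊ ≤ N := Nat.floor_mono (div_le_div_of_nonneg_right (hs j).2 hd0.le)
      have htN : ⌊t j / d⌋₊ ≤ N := Nat.floor_mono (div_le_div_of_nonneg_right (ht j).2 hd0.le)
      rw [min_eq_left hsN, min_eq_left htN] at h2
      have a1 := Nat.floor_le (div_nonneg (hs j).1 hd0.le)
      have a2 := Nat.lt_floor_add_one (s j / d)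
      have b1 := Nat.floor_le (div_nonneg (ht j).1 hd0.le)
      have b2 := Nat.lt_floor_add_one (t j / d)
      rw [h2] at a1 a2
      rw [div_lt_iff₀ hd0] at a2 b2
      rw [le_div_iff₀ hd0] at a1 b1
      rw [abs_le]; constructor <;> linarith
    calc ∑ j, |s j - t j| ≤ ∑ _j : Fin m, d := Finset.sum_le_sum fun j _ => h1 j
      _ = m * d := by simp
      _ ≤ (m + 1) * d := by linarith
      _ = δ := by rw [hd]; field_simp

theorem boxpi_ae {n m : ℕ} (H : ℝ) (D : Fin n → Measure (Fin m → ℝ))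
    [∀ i, IsProbabilityMeasure (D i)] (hD : ∀ i, suppBox H (D i)) :
    ∀ᵐ b ∂(Measure.pi D), ∀ i j, b i j ∈ Icc (0:ℝ) H := by
  refine ae_all_iff.2 fun i => ?_
  exact (measurePreserving_eval D i).quasiMeasurePreserving.ae (box_ae H (D i) (hD i))

theorem pay_le {n m : ℕ} (H : ℝ) (v : Fin n → (Fin m → ℝ) → Alloc n m → ℝ) (B : ℝ)
    (hvB : ∀ i t x, v i t x ≤ B) (M : Mechanism n m) (hIR : IsIR H v M)
    (b : Fin n → Fin m → ℝ) (hb : ∀ i j, b i j ∈ Icc (0:ℝ) H) (i : Fin n) :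
    M.pay (fun j => some (b j)) i ≤ B := by
  have h := hIR b hb i
  unfold util at h
  have h1 : ∑ x, M.allocProb (fun j => some (b j)) x * v i (b i) x ≤
      ∑ x, M.allocProb (fun j => some (b j)) x * B :=
    Finset.sum_le_sum fun x _ => mul_le_mul_of_nonneg_left (hvB _ _ _) (M.allocProb_nonneg _ _)
  rw [← Finset.sum_mul, M.allocProb_sum_one, one_mul] at h1
  linarith

theorem rev_le {n m : ℕ} (H : ℝ) (v : Fin n → (Fin m → ℝ) → Alloc n m → ℝ) (B : ℝ) (hB : 0 ≤ B)
    (hvB : ∀ i t x, v i t x ≤ B) (M : Mechanism n m) (hIR : IsIR H v M)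
    (D : Fin n → Measure (Fin m → ℝ)) [∀ i, IsProbabilityMeasure (D i)]
    (hD : ∀ i, suppBox H (D i)) : RevT M D ≤ n * B := by
  unfold RevT
  by_cases hi : Integrable (fun b => ∑ i, M.pay (fun j => some (b j)) i) (Measure.pi D)
  · have h1 : ∫ b, ∑ i, M.pay (fun j => some (b j)) i ∂(Measure.pi D) ≤
        ∫ _b, (n * B : ℝ) ∂(Measure.pi D) := by
      refine integral_mono_ae hi (integrable_const _) ?_
      filter_upwards [boxpi_ae H D hD] with b hb
      calc _ ≤ ∑ _i : Fin n, B := Finset.sum_le_sum fun i _ => pay_le H v B hvB M hIR b hb i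
        _ = n * B := by simp
    simpa using h1
  · rw [integral_undef hi]; positivity

theorem pay_integrable {n m : ℕ} (H : ℝ) (v : Fin n → (Fin m → ℝ) → Alloc n m → ℝ) (B : ℝ)
    (hB : 0 ≤ B)
    (hvB : ∀ i t x, v i t x ≤ B) (M : Mechanism n m) (hIR : IsIR H v M)
    (D : Fin n → Measure (Fin m → ℝ)) [∀ i, IsProbabilityMeasure (D i)]
    (hD : ∀ i, suppBox H (D i)) (hpos : 0 < RevT M D) (i : Fin n) :
    Integrable (fun b => M.pay (fun j => some (b j)) i) (Measure.pi D) := by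
  have hsm : Measurable (fun b : Fin n → Fin m → ℝ => fun j => some (b j)) :=
    measurable_pi_lambda _ fun j => measurable_some.comp (measurable_pi_apply j)
  have hi : Integrable (fun b => ∑ i, M.pay (fun j => some (b j)) i) (Measure.pi D) := by
    by_contra h
    unfold RevT at hpos
    rw [integral_undef h] at hpos
    exact lt_irrefl _ hpos
  refine (hi.norm.add (integrable_const (n * B + B))).mono'
    ((M.meas_pay i).comp hsm).aestronglyMeasurable ?_
  filter_upwards [boxpi_ae H D hD] with b hb
  have h1 := pay_le H v B hvB M hIR b hb
  have h2 : ∑ l, M.pay (fun j => some (b j)) l ≤ M.pay (fun j => some (b j)) i + n * B := by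
    rw [← Finset.add_sum_erase _ _ (Finset.mem_univ i)]
    refine add_le_add le_rfl ?_
    calc _ ≤ ∑ _l ∈ Finset.univ.erase i, B := Finset.sum_le_sum fun l _ => h1 l
      _ ≤ ∑ _l : Fin n, B := Finset.sum_le_sum_of_subset_of_nonneg (Finset.erase_subset _ _)
          fun _ _ _ => hB
      _ = n * B := by simp
  have h3 := neg_abs_le (∑ l, M.pay (fun j => some (b j)) l)
  have hnB : 0 ≤ n * B := by positivity
  have h4 := abs_nonneg (∑ l, M.pay (fun j => some (b j)) l)
  show |M.pay (fun j => some (b j)) i| ≤ |∑ l, M.pay (fun j => some (b j)) l| + (n * B + B)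
  rw [abs_le]
  constructor
  · linarith
  · linarith [h1 i]

theorem null_mech {n m : ℕ} (H : ℝ) (v : Fin n → (Fin m → ℝ) → Alloc n m → ℝ)
    (hv0 : ∀ i t x, 0 ≤ v i t x) (D : Fin n → Measure (Fin m → ℝ)) :
    ∃ M : Mechanism n m, IsIR H v M ∧ IsBIC 0 H v M D ∧ 0 = RevT M D := by
  refine ⟨{ allocProb := fun _ x => if x = emptyAlloc n m then 1 else 0
            pay := fun _ _ => 0
            allocProb_nonneg := fun b x => by
              split_ifs
              · exact zero_le_one
              · exact le_rfl
            allocProb_sum_one := fun b => by simp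
            optOut := fun b _ => ⟨rfl, rfl⟩
            meas_allocProb := fun x => measurable_const
            meas_pay := fun i => measurable_const }, ?_, ?_, ?_⟩
  · intro t _ i
    simp [util, hv0]
  · intro i t _ bid _
    simp [interim, util]
  · simp [RevT]

theorem opt_bounds {n m : ℕ} (H : ℝ) (v : Fin n → (Fin m → ℝ) → Alloc n m → ℝ) (B : ℝ) (hB : 0 ≤ B)
    (hv0 : ∀ i t x, 0 ≤ v i t x) (hvB : ∀ i t x, v i t x ≤ B)
    (D : Fin n → Measure (Fin m → ℝ)) [∀ i, IsProbabilityMeasure (D i)]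
    (hD : ∀ i, suppBox H (D i)) : 0 ≤ OPT 0 H v D ∧ OPT 0 H v D ≤ n * B ∧
      ∀ M : Mechanism n m, IsIR H v M → IsBIC 0 H v M D → RevT M D ≤ OPT 0 H v D := by
  have hbdd : BddAbove {r | ∃ M : Mechanism n m, IsIR H v M ∧ IsBIC 0 H v M D ∧ r = RevT M D} := by
    refine ⟨n * B, ?_⟩
    rintro r ⟨M, h1, _, rfl⟩
    exact rev_le H v B hB hvB M h1 D hD
  refine ⟨le_csSup hbdd (null_mech H v hv0 D), csSup_le ⟨0, null_mech H v hv0 D⟩ ?_,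
    fun M h1 h2 => le_csSup hbdd ⟨M, h1, h2, rfl⟩⟩
  rintro r ⟨M, h1, _, rfl⟩
  exact rev_le H v B hB hvB M h1 D hD

theorem opt_le {n m : ℕ} (H L : ℝ) (v : Fin n → (Fin m → ℝ) → Alloc n m → ℝ)
    (hL : ∀ i t t' x, |v i t x - v i t' x| ≤ L * ∑ j, |t j - t' j|) (hL0 : 0 < L)
    (B : ℝ) (hB : 0 ≤ B) (hv0 : ∀ i t x, 0 ≤ v i t x) (hvB : ∀ i t x, v i t x ≤ B)
    (hvm : ∀ i x, Measurable fun t => v i t x)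
    (D Dh : Fin n → Measure (Fin m → ℝ)) [∀ i, IsProbabilityMeasure (D i)]
    [∀ i, IsProbabilityMeasure (Dh i)]
    (hD : ∀ i, suppBox H (D i)) (hDh : ∀ i, suppBox H (Dh i)) (ε : ℝ) (hε : 0 < ε)
    (hP : ∀ i, ProkhorovLe (D i) (Dh i) ε) (ρ : ℝ) (hρ0 : 0 < ρ) (hρ1 : ρ < 1) :
    OPT 0 H v D ≤ OPT 0 H v Dh + n * (ρ * (n * B)) + 12 * (n * (L + B) * ε) / ρ := by
  obtain ⟨hO0, hO1, hO2⟩ := opt_bounds H v B hB hv0 hvB Dh hDh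
  refine csSup_le ⟨0, null_mech H v hv0 D⟩ ?_
  rintro r ⟨M, hIR, hBIC, rfl⟩
  have hn1 : 0 ≤ n * (ρ * (n * B)) := by positivity
  have hn2 : 0 ≤ 12 * (n * (L + B) * ε) / ρ := by positivity
  rcases le_or_gt (RevT M D) 0 with h0 | hpos
  · linarith
  obtain ⟨N, c, hc, hcδ⟩ := cells_exist m H ε hε
  obtain ⟨Mh, h1, h2, h3⟩ := one_sided H L v hL hL0.le B hB hv0 hvB hvm D Dh hD ε (2 * ε)
    (by linarith) hP (by linarith) M hBIC
    (fun i => pay_integrable H v B hB hvB M hIR D hD hpos i) c hc ε hε.le hcδ ρ (L * ε) hρ0 hρ1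
    (by positivity)
  have h4 := hO2 Mh h1 h2
  have h5 := rev_le H v B hB hvB M hIR D hD
  have h6 : 1 - n * ρ ≤ (1 - ρ) ^ n := by
    have := one_add_mul_le_pow (a := -ρ) (by linarith) n
    simpa [sub_eq_add_neg] using this
  have h7 := mul_le_mul_of_nonneg_right h6 hpos.le
  have h8 : n * ρ * RevT M D ≤ n * ρ * (n * B) := mul_le_mul_of_nonneg_left h5 (by positivity)
  have h9 : (2 * ((2 * L + 2 * B) * (2 * ε)) + 2 * L * ε + L * ε) / ρ + L * ε ≤
      12 * ((L + B) * ε) / ρ := by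
    have : L * ε ≤ L * ε / ρ := by
      rw [le_div_iff₀ hρ0]
      exact mul_le_of_le_one_right (by positivity) hρ1.le
    calc _ ≤ (2 * ((2 * L + 2 * B) * (2 * ε)) + 2 * L * ε + L * ε) / ρ + L * ε / ρ := by linarith
      _ = (2 * ((2 * L + 2 * B) * (2 * ε)) + 2 * L * ε + L * ε + L * ε) / ρ := by ring
      _ ≤ _ := by
        refine div_le_div_of_nonneg_right ?_ hρ0.le
        have : 0 ≤ B * ε := by positivity
        nlinarith
  have h10 := mul_le_mul_of_nonneg_left h9 (Nat.cast_nonneg (α := ℝ) n)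
  have h11 : (n : ℝ) * (12 * ((L + B) * ε) / ρ) = 12 * (n * (L + B) * ε) / ρ := by ring
  rw [h11] at h10
  linarith

theorem clamp_lip (H a b : ℝ) : |max 0 (min a H) - max 0 (min b H)| ≤ |a - b| := by
  have h1 := abs_max_sub_max_le_max 0 (min a H) 0 (min b H)
  have h2 := abs_min_sub_min_le_max a H b H
  simp at h1 h2
  exact h1.trans h2

theorem msupport_box {m : ℕ} (H : ℝ) (μ : Measure (Fin m → ℝ)) [IsProbabilityMeasure μ]
    (h : suppBox H μ) (t : Fin m → ℝ) (ht : t ∈ msupport μ) : ∀ j, t j ∈ Icc (0:ℝ) H := by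
  by_contra hn
  have hcl : IsClosed {t : Fin m → ℝ | ∀ j, t j ∈ Icc (0:ℝ) H} := by
    have : {t : Fin m → ℝ | ∀ j, t j ∈ Icc (0:ℝ) H} = ⋂ j, (fun t => t j) ⁻¹' Icc (0:ℝ) H := by
      ext; simp
    rw [this]
    exact isClosed_iInter fun j => isClosed_Icc.preimage (continuous_apply j)
  have h1 := ht _ hcl.isOpen_compl hn
  have h2 : μ {t : Fin m → ℝ | ∀ j, t j ∈ Icc (0:ℝ) H}ᶜ = 0 := box_ae H μ h
  rw [h2] at h1
  exact lt_irrefl _ h1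

theorem opt_congr {n m : ℕ} (H : ℝ) (v v' : Fin n → (Fin m → ℝ) → Alloc n m → ℝ)
    (hvv : ∀ i t x, (∀ j, t j ∈ Icc (0:ℝ) H) → v i t x = v' i t x)
    (D : Fin n → Measure (Fin m → ℝ)) [∀ i, IsProbabilityMeasure (D i)]
    (hD : ∀ i, suppBox H (D i)) : OPT 0 H v D = OPT 0 H v' D := by
  have hu : ∀ M i t b, (∀ j, t j ∈ Icc (0:ℝ) H) → util v M i t b = util v' M i t b := by
    intro M i t b ht
    unfold util
    simp_rw [hvv i t _ ht]
  have h1 : ∀ M, IsIR H v M ↔ IsIR H v' M := by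
    intro M
    refine forall_congr' fun t => forall_congr' fun ht => forall_congr' fun i => ?_
    rw [hu M i (t i) _ (ht i)]
  have h2 : ∀ M, IsBIC 0 H v M D ↔ IsBIC 0 H v' M D := by
    intro M
    refine forall_congr' fun i => forall_congr' fun t => forall_congr' fun ht =>
      forall_congr' fun bid => forall_congr' fun _ => ?_
    have hb := msupport_box H (D i) (hD i) t ht
    unfold interim
    simp_rw [hu M i t _ hb]
  unfold OPT
  simp_rw [h1, h2]

theorem lip_meas {m : ℕ} (L : ℝ) (f : (Fin m → ℝ) → ℝ) (hL : 0 ≤ L)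
    (hf : ∀ t t', |f t - f t'| ≤ L * ∑ j, |t j - t' j|) : Measurable f := by
  refine (LipschitzWith.of_dist_le_mul (K := (L * m).toNNReal) fun t t' => ?_).continuous.measurable
  rw [Real.coe_toNNReal _ (by positivity), Real.dist_eq, mul_assoc]
  refine (hf t t').trans (mul_le_mul_of_nonneg_left ?_ hL)
  calc ∑ j, |t j - t' j| ≤ ∑ _j : Fin m, dist t t' :=
        Finset.sum_le_sum fun j _ => by rw [← Real.dist_eq]; exact dist_le_pi_dist t t' j
    _ = m * dist t t' := by simp

theorem final_arith (n m : ℕ) (H L ε X Y : ℝ) (hH : 0 < H) (hL : 0 < L) (hε : 0 < ε)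
    (hX : X ≤ n * (m * L * H)) (hY : 0 ≤ Y)
    (h : ∀ ρ, 0 < ρ → ρ < 1 → X ≤ Y + n * (ρ * (n * (m * L * H))) +
      12 * (n * (L + m * L * H) * ε) / ρ) :
    X - Y ≤ 13 * (n * (1 * (n * m * L * H * ε + m * L * Real.sqrt (n * H * ε))) +
            n * Real.sqrt (m * L * H *
              (1 * (n * m * L * H * ε + m * L * Real.sqrt (n * H * ε))))) := by
  set B := m * L * H with hB
  set κ := 1 * (n * m * L * H * ε + m * L * Real.sqrt (n * H * ε)) with hκ
  have hB0 : 0 ≤ B := by positivity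
  have hκ0 : 0 ≤ κ := by positivity
  have hn0 : (0:ℝ) ≤ n := Nat.cast_nonneg n
  have hr0 : 0 ≤ Real.sqrt (B * κ) := Real.sqrt_nonneg _
  have hnk : 0 ≤ n * κ := by positivity
  have hnr : 0 ≤ n * Real.sqrt (B * κ) := by positivity
  rcases Nat.eq_zero_or_pos n with hn | hn
  · subst hn
    simp at hX ⊢
    linarith
  have hn1 : (1:ℝ) ≤ n := by exact_mod_cast hn
  rcases le_or_gt B κ with hBκ | hκB
  · have h1 : B ≤ Real.sqrt (B * κ) := Real.le_sqrt_of_sq_le (by nlinarith)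
    have h2 := mul_le_mul_of_nonneg_left h1 hn0
    linarith
  have hBpos : 0 < B := lt_of_le_of_lt hκ0 hκB
  have hm : m ≠ 0 := by
    rintro rfl
    simp [hB] at hBpos
  have hm1 : (1:ℝ) ≤ m := by exact_mod_cast Nat.one_le_iff_ne_zero.2 hm
  have hs0 := Real.sqrt_nonneg (n * H * ε)
  have hκpos : 0 < κ := by positivity
  have hsH : Real.sqrt (n * H * ε) < H := by
    by_contra hcon
    push Not at hcon
    have h1 : m * L * H ≤ m * L * Real.sqrt (n * H * ε) :=
      mul_le_mul_of_nonneg_left hcon (by positivity)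
    have h2 : 0 ≤ n * m * L * H * ε := by positivity
    linarith
  have hnε : n * ε ≤ Real.sqrt (n * H * ε) := by
    have h1 : n * H * ε < H ^ 2 := (Real.sqrt_lt' hH).1 hsH
    have h2 : n * ε < H := by
      by_contra hcon
      push Not at hcon
      nlinarith [mul_le_mul_of_nonneg_left hcon hH.le]
    refine Real.le_sqrt_of_sq_le ?_
    have : 0 ≤ n * ε := by positivity
    nlinarith [mul_le_mul_of_nonneg_left h2.le this]
  have hkey : n * (L + B) * ε ≤ κ := by
    have h1 : L * (n * ε) ≤ m * L * Real.sqrt (n * H * ε) := by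
      calc L * (n * ε) ≤ L * Real.sqrt (n * H * ε) := mul_le_mul_of_nonneg_left hnε hL.le
        _ = 1 * (L * Real.sqrt (n * H * ε)) := by ring
        _ ≤ m * (L * Real.sqrt (n * H * ε)) := mul_le_mul_of_nonneg_right hm1 (by positivity)
        _ = _ := by ring
    have h2 : n * (L + B) * ε = L * (n * ε) + n * m * L * H * ε := by rw [hB]; ring
    rw [h2, hκ]; linarith
  set r := Real.sqrt (B * κ) with hr
  have hrr : r * r = B * κ := Real.mul_self_sqrt (by positivity)
  have hrpos : 0 < r := Real.sqrt_pos.2 (by positivity)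
  have hrB : r < B := (Real.sqrt_lt' hBpos).2 (by nlinarith)
  have h1 := h (r / (n * B)) (by positivity) (by
    rw [div_lt_one (by positivity)]
    nlinarith)
  have h2 : n * (r / (n * B) * (n * B)) = n * r := by
    rw [div_mul_cancel₀ _ (by positivity)]
  have h3 : 12 * (n * (L + B) * ε) / (r / (n * B)) ≤ 12 * (n * r) := by
    rw [div_le_iff₀ (by positivity)]
    have : 12 * (n * r) * (r / (n * B)) = 12 * κ := by
      have : (n:ℝ) ≠ 0 := by positivity
      field_simp
      nlinarith
    rw [this]; linarith
  rw [h2] at h1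
  linarith

end MultiItem

open MultiItem
theorem stmt13 :
    ∃ C C' : ℝ, 0 < C ∧ 0 < C' ∧
      ∀ (n m : ℕ) (H L ε : ℝ), 0 < H → 0 < L → 0 < ε →
      ∀ v : Fin n → (Fin m → ℝ) → Alloc n m → ℝ,
        (∀ i t x, (∀ j, t j ∈ Icc (0:ℝ) H) → 0 ≤ v i t x) →
        (∀ i t x, (∀ j, t j ∈ Icc (0:ℝ) H) → v i t x ≤ m * L * H) →
        (∀ i t t' x, |v i t x - v i t' x| ≤ L * ∑ j, |t j - t' j|) →
      ∀ D Dhat : Fin n → Measure (Fin m → ℝ),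
        (∀ i, IsProbabilityMeasure (D i)) → (∀ i, suppBox H (D i)) →
        (∀ i, IsProbabilityMeasure (Dhat i)) → (∀ i, suppBox H (Dhat i)) →
        (∀ i, ProkhorovLe (D i) (Dhat i) ε) →
        |OPT 0 H v D - OPT 0 H v Dhat| ≤
          C * (n * (C' * (n * m * L * H * ε + m * L * Real.sqrt (n * H * ε))) +
            n * Real.sqrt (m * L * H *
              (C' * (n * m * L * H * ε + m * L * Real.sqrt (n * H * ε))))) := by
  refine ⟨13, 1, by norm_num, by norm_num, ?_⟩
  intro n m H L ε hH hL hε v hv0 hvB hvL D Dhat hDp hD hDhp hDh hP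
  set v' : Fin n → (Fin m → ℝ) → Alloc n m → ℝ := fun i t x =>
    v i (fun j => max 0 (min (t j) H)) x with hv'
  have hbox : ∀ (t : Fin m → ℝ) j, max 0 (min (t j) H) ∈ Icc (0:ℝ) H := fun t j =>
    ⟨le_max_left _ _, max_le hH.le (min_le_right _ _)⟩
  have hvv : ∀ i t x, (∀ j, t j ∈ Icc (0:ℝ) H) → v i t x = v' i t x := by
    intro i t x ht
    have : (fun j => max 0 (min (t j) H)) = t := by
      funext j
      rw [min_eq_left (ht j).2, max_eq_right (ht j).1]
    simp only [hv', this]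
  have hB : 0 ≤ m * L * H := by positivity
  have h0 : ∀ i t x, 0 ≤ v' i t x := fun i t x => hv0 i _ x (hbox t)
  have h1 : ∀ i t x, v' i t x ≤ m * L * H := fun i t x => hvB i _ x (hbox t)
  have h2 : ∀ i t t' x, |v' i t x - v' i t' x| ≤ L * ∑ j, |t j - t' j| := fun i t t' x =>
    (hvL i _ _ x).trans (mul_le_mul_of_nonneg_left
      (Finset.sum_le_sum fun j _ => clamp_lip H (t j) (t' j)) hL.le)
  have h3 : ∀ i x, Measurable fun t => v' i t x := fun i x =>
    lip_meas L _ hL.le fun t t' => h2 i t t' x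
  rw [opt_congr H v v' hvv D hD, opt_congr H v v' hvv Dhat hDh]
  obtain ⟨a1, a2, _⟩ := opt_bounds H v' _ hB h0 h1 D hD
  obtain ⟨b1, b2, _⟩ := opt_bounds H v' _ hB h0 h1 Dhat hDh
  rw [abs_sub_le_iff]
  constructor
  · exact final_arith n m H L ε _ _ hH hL hε a2 b1 fun ρ hρ0 hρ1 =>
      opt_le H L v' h2 hL _ hB h0 h1 h3 D Dhat hD hDh ε hε hP ρ hρ0 hρ1
  · exact final_arith n m H L ε _ _ hH hL hε b2 a1 fun ρ hρ0 hρ1 =>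
      opt_le H L v' h2 hL _ hB h0 h1 h3 Dhat D hDh hD ε hε (fun i => prok_symm (hP i)) ρ hρ0 hρ1
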